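/- arXiv:1304.2505 — 5 statements merged into one kernel-verified Lean document; each statement's English description precedes it below -/
import Mathlib

section
/- Let c, d > 0 and let g be a complex-valued function analytic on an open subset of the complex plane containing the closed rectangle {θ ∈ ℂ : -π ≤ Re θ ≤ π, -δ ≤ Im θ ≤ γ}, where 0 < γ < c and 0 < δ < d. Let N be an even positive integer and let θ_k = -π + (k - 1/2)(2π/N) for k = 1, …, N be the midpoint nodes. Then ∫_{-π}^{π} g(θ) dθ - (2π/N) Σ_{k=1}^{N} g(θ_k) = E₊(γ) + E₋(δ), where E₊(γ) = (1/2) [∫ along the straight segment from -π to -π+iγ + ∫ along the straight segment from -π+iγ to π+iγ + ∫ along the straight segment from π+iγ to π] of (1 + i·tan(Nθ/2)) g(θ) dθ, and E₋(δ) = (1/2) [∫ along the straight segment from -π to -π-iδ + ∫ along the straight segment from -π-iδ to π-iδ + ∫ along the straight segment from π-iδ to π] of (1 - i·tan(Nθ/2)) g(θ) dθ. -/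
open Complex Real

/-- The integral of `f` along the straight line segment from `a` to `b` in `ℂ`. -/
noncomputable def segIntegral (f : ℂ → ℂ) (a b : ℂ) : ℂ :=
  (b - a) * ∫ s in (0:ℝ)..1, f (a + (s : ℂ) * (b - a))

open Filter Topology Set

/-- Fundamental theorem of calculus along a straight line segment. -/
lemma segIntegral_eq_sub_of_hasDerivAt {f F : ℂ → ℂ} {a b : ℂ}
    (hF : ∀ s ∈ Icc (0 : ℝ) 1, HasDerivAt F (f (a + s * (b - a))) (a + s * (b - a)))
    (hf : ∀ s ∈ Icc (0 : ℝ) 1, ContinuousAt f (a + s * (b - a))) :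
    segIntegral f a b = F b - F a := by
  have hpath (s : ℝ) : HasDerivAt (fun s : ℝ => a + (s : ℂ) * (b - a)) (b - a) s := by
    simpa using ((hasDerivAt_id s).ofReal_comp.mul_const (b - a)).const_add a
  have key : ∫ s in (0 : ℝ)..1, f (a + (s : ℂ) * (b - a)) * (b - a) = F b - F a := by
    rw [intervalIntegral.integral_eq_sub_of_hasDerivAt (f := fun s : ℝ => F (a + (s : ℂ) * (b - a)))]
    · simp
    · intro s hs
      rw [uIcc_of_le zero_le_one] at hs
      exact (hF s hs).comp s (hpath s)
    · refine ContinuousOn.intervalIntegrable fun s hs => ?_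
      rw [uIcc_of_le zero_le_one] at hs
      have h := ContinuousAt.comp (f := fun s : ℝ => a + (s : ℂ) * (b - a))
        (hf s hs) (hpath s).continuousAt
      exact (h.mul continuousAt_const).continuousWithinAt
  rw [segIntegral, ← key, intervalIntegral.integral_mul_const, mul_comm]

/-- On a convex open set, a function with finitely many simple poles has a primitive after its
principal parts are subtracted. -/
lemma exists_hasDerivAt_sub_principalParts {V : Set ℂ} (hV : IsOpen V) (hconv : Convex ℝ V)
    (S : Finset ℂ) (r f : ℂ → ℂ) (hf : ∀ z ∈ V, z ∉ S → DifferentiableAt ℂ f z)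
    (hr : ∀ a ∈ S, Tendsto (fun z => (z - a) * f z) (𝓝[≠] a) (𝓝 (r a))) :
    ∃ H : ℂ → ℂ, ∀ z ∈ V, z ∉ S → HasDerivAt H (f z - ∑ a ∈ S, r a / (z - a)) z := by
  classical
  set k : ℂ → ℂ := fun z => f z - ∑ a ∈ S, r a / (z - a) with hk
  set h : ℂ → ℂ := fun z => if z ∈ S then limUnder (𝓝[≠] z) k else k z with hh
  have hkd : ∀ z ∈ V, z ∉ S → DifferentiableAt ℂ k z := fun z hz hzS => by
    refine (hf z hz hzS).sub (DifferentiableAt.fun_sum fun a ha => ?_)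
    exact (differentiableAt_const _).div (by fun_prop)
      (sub_ne_zero.2 fun e => hzS (e ▸ ha))
  have hnear : ∀ z, z ∉ S → h =ᶠ[𝓝 z] k := fun z hz => by
    filter_upwards [S.finite_toSet.isClosed.isOpen_compl.mem_nhds hz] with w hw
    exact if_neg hw
  have hpunct : ∀ a, ∀ᶠ z in 𝓝[≠] a, z ∉ S := fun a => by
    have : ((S : Set ℂ) \ {a})ᶜ ∈ 𝓝 a :=
      (S.finite_toSet.subset sdiff_subset).isClosed.isOpen_compl.mem_nhds (by simp)
    filter_upwards [nhdsWithin_le_nhds this, self_mem_nhdsWithin] with z hz hza hzS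
    exact hz ⟨hzS, hza⟩
  have hhd : ∀ z ∈ V, z ∉ S → DifferentiableAt ℂ h z := fun z hz hzS =>
    (hkd z hz hzS).congr_of_eventuallyEq (hnear z hzS)
  have hdiff : DifferentiableOn ℂ h V := by
    intro a haV
    by_cases haS : a ∈ S
    swap
    · exact (hhd a haV haS).differentiableWithinAt
    have hVa : ∀ᶠ z in 𝓝[≠] a, z ∈ V := nhdsWithin_le_nhds (hV.mem_nhds haV)
    have hid : Tendsto (fun z : ℂ => z - a) (𝓝[≠] a) (𝓝 0) := by
      have : ContinuousAt (fun z : ℂ => z - a) a := by fun_prop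
      simpa using this.tendsto.mono_left nhdsWithin_le_nhds
    have hlim : Tendsto (fun z => (z - a) * k z) (𝓝[≠] a) (𝓝 0) := by
      have hterm : ∀ b ∈ S, Tendsto (fun z => (z - a) * (r b / (z - b))) (𝓝[≠] a)
          (𝓝 (if b = a then r b else 0)) := by
        intro b _
        split_ifs with hb
        · subst hb
          refine tendsto_const_nhds.congr' ?_
          filter_upwards [self_mem_nhdsWithin] with z hz
          have : z - b ≠ 0 := sub_ne_zero.2 hz
          field_simp
        · have hc : ContinuousAt (fun z => r b / (z - b)) a :=
            continuousAt_const.div (by fun_prop) (sub_ne_zero.2 (Ne.symm hb))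
          simpa using hid.mul (hc.tendsto.mono_left nhdsWithin_le_nhds)
      have := (hr a haS).sub (tendsto_finsetSum S hterm)
      rw [Finset.sum_ite_eq' S a r, if_pos haS, sub_self] at this
      refine this.congr fun z => ?_
      rw [hk, mul_sub, Finset.mul_sum]
    have ho : (fun z => k z - k a) =o[𝓝[≠] a] fun z => (z - a)⁻¹ := by
      rw [Asymptotics.isLittleO_iff_tendsto']
      · simpa [mul_sub, mul_comm] using hlim.sub (hid.mul_const (k a))
      · filter_upwards [self_mem_nhdsWithin] with z hz h0
        exact absurd (inv_eq_zero.1 h0) (sub_ne_zero.2 hz)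
    have hkt := Complex.tendsto_limUnder_of_differentiable_on_punctured_nhds_of_isLittleO
      (by filter_upwards [hVa, hpunct a] with z hz hzS using hkd z hz hzS) ho
    have hcont : ContinuousAt h a := by
      rw [continuousAt_iff_punctured_nhds, hh]
      simp only [if_pos haS]
      refine hkt.congr' ?_
      filter_upwards [hpunct a] with z hz using (if_neg hz).symm
    exact (analyticAt_of_differentiable_on_punctured_nhds_of_continuousAt
      (by filter_upwards [hVa, hpunct a] with z hz hzS using hhd z hz hzS)
      hcont).differentiableAt.differentiableWithinAt
  obtain ⟨H, hH⟩ := hconv.exists_forall_hasDerivWithinAt hdiff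
  refine ⟨H, fun z hz hzS => ?_⟩
  have := (hH z hz).hasDerivAt (hV.mem_nhds hz)
  rwa [(hnear z hzS).eq_of_nhds] at this

/-- The increments over `[-R, R]` of primitives of `1 / (z - t)` cut below and above the pole. -/
lemma log_increment_sub_log_increment {t R : ℝ} (h₁ : -R < t) (h₂ : t < R) :
    (log (-I * (R - t)) - log (-I * (-R - t))) - (log (I * (R - t)) - log (I * (-R - t))) =
      -(2 * π * I) := by
  have e₁ : -I * ((R : ℂ) - t) = (R - t : ℝ) * -I := by push_cast; ring
  have e₂ : -I * (-(R : ℂ) - t) = (R + t : ℝ) * I := by push_cast; ring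
  have e₃ : I * ((R : ℂ) - t) = (R - t : ℝ) * I := by push_cast; ring
  have e₄ : I * (-(R : ℂ) - t) = (R + t : ℝ) * -I := by push_cast; ring
  have p₁ : 0 < R - t := by linarith
  have p₂ : 0 < R + t := by linarith
  rw [e₁, e₂, e₃, e₄, log_ofReal_mul p₁ (by simp), log_ofReal_mul p₂ (by simp),
    log_ofReal_mul p₁ (by simp), log_ofReal_mul p₂ (by simp), log_I, log_neg_I]
  ring

/-- The zeros of `cos (N z / 2)` in the strip `|re z| < π + π / N` are the
midpoint nodes. -/
lemma exists_midpoint_of_cos_eq_zero {N : ℕ} (hN : 0 < N) (hNeven : Even N) {z : ℂ}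
    (hz : |z.re| < π + π / N) (hcos : Complex.cos (N * z / 2) = 0) :
    ∃ k ∈ Finset.Icc 1 N, ((-π + ((k : ℝ) - 1/2) * (2 * π / N) : ℝ) : ℂ) = z := by
  obtain ⟨m, rfl⟩ := hNeven
  obtain ⟨j, hj⟩ := Complex.cos_eq_zero_iff.1 hcos
  have hm : (0 : ℝ) < m := by exact_mod_cast (by omega : 0 < m)
  have hmC : (m : ℂ) ≠ 0 := by exact_mod_cast hm.ne'
  have hzr : z = (((2 * j + 1) * π / (2 * m) : ℝ) : ℂ) := by
    push_cast at hj ⊢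
    field_simp
    linear_combination 2 * hj
  have hre : z.re = (2 * j + 1) * π / (2 * m) := by rw [hzr, ofReal_re]
  rw [hre, abs_lt] at hz
  push_cast at hz
  have hpi := Real.pi_pos
  have e : π + π / ((m : ℝ) + m) = (2 * m + 1) * π / (2 * m) := by field_simp; ring
  rw [e, ← neg_div, div_lt_div_iff_of_pos_right (by positivity),
    div_lt_div_iff_of_pos_right (by positivity), ← neg_mul, mul_lt_mul_iff_left₀ hpi,
    mul_lt_mul_iff_left₀ hpi] at hz
  have h₁ : -(2 * (m : ℤ) + 1) < 2 * j + 1 := by exact_mod_cast hz.1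
  have h₂ : 2 * j + 1 < 2 * (m : ℤ) + 1 := by exact_mod_cast hz.2
  refine ⟨(j + m + 1).toNat, by rw [Finset.mem_Icc]; omega, ?_⟩
  have hk : (((j + m + 1).toNat : ℕ) : ℝ) = j + m + 1 := by
    have : (((j + m + 1).toNat : ℕ) : ℤ) = j + m + 1 := Int.toNat_of_nonneg (by omega)
    exact_mod_cast this
  rw [hzr, hk]
  congr 1
  push_cast
  field_simp
  ring

/-- `cos (N z / 2)` vanishes at the midpoint nodes when `N` is even. -/
lemma cos_midpoint_eq_zero {N : ℕ} (hN : 0 < N) (hNeven : Even N) (k : ℕ) :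
    Complex.cos (N * ((-π + ((k : ℝ) - 1/2) * (2 * π / N) : ℝ) : ℂ) / 2) = 0 := by
  obtain ⟨m, rfl⟩ := hNeven
  have hmC : (m : ℂ) ≠ 0 := by exact_mod_cast (by omega : m ≠ 0)
  refine Complex.cos_eq_zero_iff.2 ⟨k - m - 1, ?_⟩
  push_cast
  field_simp
  ring

/-- The residue of `tan (n z / 2) * g z` at a pole of the tangent. -/
lemma tendsto_sub_mul_tan_mul {n a : ℂ} {g : ℂ → ℂ} (hn : n ≠ 0)
    (ha : Complex.cos (n * a / 2) = 0) (hg : ContinuousAt g a) :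
    Tendsto (fun z => (z - a) * (Complex.tan (n * z / 2) * g z)) (𝓝[≠] a) (𝓝 (-(2 / n) * g a)) := by
  have hsin : Complex.sin (n * a / 2) ≠ 0 := fun h => by
    simpa [h, ha] using Complex.sin_sq_add_cos_sq (n * a / 2)
  have hd : HasDerivAt (fun z => Complex.cos (n * z / 2)) (-Complex.sin (n * a / 2) * (n / 2)) a := by
    have : HasDerivAt (fun z : ℂ => n * z / 2) (n / 2) a := by
      simpa using ((hasDerivAt_id a).const_mul n).div_const 2
    exact this.ccos
  have hs := (hasDerivAt_iff_tendsto_slope.1 hd).inv₀ (by simp [hsin, hn])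
  have hc : ContinuousAt (fun z => Complex.sin (n * z / 2) * g z) a :=
    ContinuousAt.mul (by fun_prop) hg
  have := hs.mul (hc.tendsto.mono_left (nhdsWithin_le_nhds (s := {a}ᶜ)))
  convert this using 2
  · simp only [slope_def_field, ha, Complex.tan, sub_zero, inv_div]
    ring
  · field_simp

/-- **Midpoint rule error formula, even case.**
If `g` is analytic on an open set containing the closed rectangle
`[-π, π] × [-δ, γ]` (with `0 < γ < c`, `0 < δ < d`), and `N` is an even positive
integer, then the midpoint rule error equals `E₊(γ) + E₋(δ)`, where the error
integrals involve the kernels `1 ± i·tan(Nθ/2)` along the indicated segments. -/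
theorem midpoint_error_formula_even
    (c d : ℝ) (hc : 0 < c) (hd : 0 < d) (γ δ : ℝ)
    (hγ0 : 0 < γ) (hγc : γ < c) (hδ0 : 0 < δ) (hδd : δ < d)
    (g : ℂ → ℂ) (U : Set ℂ) (hU : IsOpen U)
    (hrect : {θ : ℂ | -π ≤ θ.re ∧ θ.re ≤ π ∧ -δ ≤ θ.im ∧ θ.im ≤ γ} ⊆ U)
    (hg : ∀ z ∈ U, AnalyticAt ℂ g z)
    (N : ℕ) (hN : 0 < N) (hNeven : Even N) :
    (∫ x in (-π : ℝ)..π, g (x : ℂ)) -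
      (2 * π / N) * ∑ k ∈ Finset.Icc 1 N, g ((-π + ((k : ℝ) - 1/2) * (2 * π / N) : ℝ) : ℂ) =
    (1/2) * (segIntegral (fun θ => (1 + I * Complex.tan (N * θ / 2)) * g θ)
                (-(π:ℂ)) (-(π:ℂ) + I * γ)
            + segIntegral (fun θ => (1 + I * Complex.tan (N * θ / 2)) * g θ)
                (-(π:ℂ) + I * γ) ((π:ℂ) + I * γ)
            + segIntegral (fun θ => (1 + I * Complex.tan (N * θ / 2)) * g θ)
                ((π:ℂ) + I * γ) (π:ℂ))
    + (1/2) * (segIntegral (fun θ => (1 - I * Complex.tan (N * θ / 2)) * g θ)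
                (-(π:ℂ)) (-(π:ℂ) - I * δ)
            + segIntegral (fun θ => (1 - I * Complex.tan (N * θ / 2)) * g θ)
                (-(π:ℂ) - I * δ) ((π:ℂ) - I * δ)
            + segIntegral (fun θ => (1 - I * Complex.tan (N * θ / 2)) * g θ)
                ((π:ℂ) - I * δ) (π:ℂ)) := by
  have hpi := Real.pi_pos
  have hNr : (0 : ℝ) < N := by exact_mod_cast hN
  have hNC : (N : ℂ) ≠ 0 := by exact_mod_cast hN.ne'
  set θ : ℕ → ℝ := fun k => -π + ((k : ℝ) - 1/2) * (2 * π / N) with hθ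
  have hθinj : Function.Injective fun k => (θ k : ℂ) := by
    intro i j hij
    have : θ i = θ j := ofReal_injective hij
    simp only [hθ] at this
    have h2 : 2 * π / N ≠ 0 := by positivity
    have := mul_right_cancel₀ h2 (add_left_cancel this)
    exact_mod_cast (sub_left_injective this : (i : ℝ) = j)
  have hθmem : ∀ k ∈ Finset.Icc 1 N, -π < θ k ∧ θ k < π := by
    intro k hk
    rw [Finset.mem_Icc] at hk
    have h1 : (1 : ℝ) ≤ k := by exact_mod_cast hk.1
    have h2 : (k : ℝ) ≤ N := by exact_mod_cast hk.2
    have hq : 0 < 2 * π / N := by positivity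
    have e : (N : ℝ) * (2 * π / N) = 2 * π := by field_simp
    simp only [hθ]
    constructor <;> nlinarith
  set S : Finset ℂ := (Finset.Icc 1 N).image fun k => (θ k : ℂ) with hS
  set R : Set ℂ := {θ : ℂ | -π ≤ θ.re ∧ θ.re ≤ π ∧ -δ ≤ θ.im ∧ θ.im ≤ γ} with hR
  have hReq : R = Icc (-π) π ×ℂ Icc (-δ) γ := by
    ext z; simp [hR, mem_reProdIm, and_assoc]
  obtain ⟨V, hVo, hVc, hRV, hVU, hVre⟩ : ∃ V : Set ℂ, IsOpen V ∧ Convex ℝ V ∧ R ⊆ V ∧ V ⊆ U ∧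
      ∀ z ∈ V, |z.re| < π + π / N := by
    have hW : IsOpen (U ∩ {z : ℂ | |z.re| < π + π / N}) :=
      hU.inter (isOpen_lt (by fun_prop) continuous_const)
    have hRc : IsCompact R := by
      rw [hReq]; exact isCompact_Icc.reProdIm isCompact_Icc
    have hRW : R ⊆ U ∩ {z : ℂ | |z.re| < π + π / N} := fun z hz => by
      refine ⟨hrect hz, ?_⟩
      have : 0 < π / N := by positivity
      have := abs_le.2 ⟨hz.1, hz.2.1⟩
      change |z.re| < _
      linarith
    obtain ⟨ε, hε, hsub⟩ := hRc.exists_thickening_subset_open hW hRW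
    have hconv : Convex ℝ R := by
      rw [hReq]
      exact ((convex_Icc (-π) π).linear_preimage reLm).inter
        ((convex_Icc (-δ) γ).linear_preimage imLm)
    exact ⟨_, Metric.isOpen_thickening, hconv.thickening ε, Metric.self_subset_thickening hε R,
      fun z hz => (hsub hz).1, fun z hz => (hsub hz).2⟩
  have hgd : ∀ z ∈ V, DifferentiableAt ℂ g z := fun z hz => (hg z (hVU hz)).differentiableAt
  have hcos : ∀ z ∈ V, z ∉ S → Complex.cos (N * z / 2) ≠ 0 := fun z hz hzS h0 => by
    obtain ⟨k, hk, hkz⟩ := exists_midpoint_of_cos_eq_zero hN hNeven (hVre z hz) h0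
    exact hzS (Finset.mem_image.2 ⟨k, hk, hkz⟩)
  have htan : ∀ z ∈ V, z ∉ S → DifferentiableAt ℂ (fun z => Complex.tan (N * z / 2)) z :=
    fun z hz hzS => DifferentiableAt.comp (g := Complex.tan) (f := fun z : ℂ => N * z / 2) z
      (Complex.differentiableAt_tan.2 (hcos z hz hzS)) (by fun_prop)
  have hSV : ∀ a ∈ S, a ∈ V ∧ Complex.cos (N * a / 2) = 0 := fun a ha => by
    obtain ⟨k, hk, rfl⟩ := Finset.mem_image.1 ha
    refine ⟨hRV ?_, cos_midpoint_eq_zero hN hNeven k⟩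
    have := hθmem k hk
    simp only [hR, mem_ofPred_eq, ofReal_re, ofReal_im]
    exact ⟨this.1.le, this.2.le, by linarith, hγ0.le⟩
  obtain ⟨G, hG⟩ := hVc.exists_forall_hasDerivWithinAt
    (fun z hz => (hgd z hz).differentiableWithinAt : DifferentiableOn ℂ g V)
  replace hG : ∀ z ∈ V, HasDerivAt G (g z) z := fun z hz => (hG z hz).hasDerivAt (hVo.mem_nhds hz)
  set r : ℂ → ℂ := fun a => -(2 / N) * g a with hr
  obtain ⟨H, hH⟩ := exists_hasDerivAt_sub_principalParts hVo hVc S r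
    (fun z => Complex.tan (N * z / 2) * g z) (fun z hz hzS => (htan z hz hzS).mul (hgd z hz))
    (fun a ha => tendsto_sub_mul_tan_mul hNC (hSV a ha).2 (hgd a (hSV a ha).1).continuousAt)
  have hprim : ∀ c : ℂ, c ≠ 0 → ∀ z ∈ V, z ∉ S → (∀ a ∈ S, c * (z - a) ∈ slitPlane) →
      HasDerivAt (fun z => H z + ∑ a ∈ S, r a * Complex.log (c * (z - a)))
        (Complex.tan (N * z / 2) * g z) z := by
    intro c hc z hz hzS hslit
    have hsum : HasDerivAt (fun z => ∑ a ∈ S, r a * Complex.log (c * (z - a)))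
        (∑ a ∈ S, r a / (z - a)) z := by
      refine HasDerivAt.fun_sum fun a ha => ?_
      have hl : HasDerivAt (fun z : ℂ => c * (z - a)) c z := by
        simpa using ((hasDerivAt_id z).sub_const a).const_mul c
      refine ((hl.clog (hslit a ha)).const_mul (r a)).congr_deriv ?_
      have : z - a ≠ 0 := sub_ne_zero.2 fun e => hzS (e ▸ ha)
      field_simp
    exact ((hH z hz hzS).add hsum).congr_deriv (sub_add_cancel _ _)
  have hreal : ∀ a ∈ S, a.im = 0 ∧ -π < a.re ∧ a.re < π := fun a ha => by
    obtain ⟨k, hk, rfl⟩ := Finset.mem_image.1 ha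
    exact ⟨ofReal_im _, by simpa using hθmem k hk⟩
  have hoff : ∀ z : ℂ, (z.im ≠ 0 ∨ z.re = π ∨ z.re = -π) → z ∉ S := fun z hz hzS => by
    obtain ⟨h0, h1, h2⟩ := hreal z hzS
    rcases hz with h | h | h
    · exact h h0
    · linarith
    · linarith
  set A : ℂ → ℂ := fun z => H z + ∑ a ∈ S, r a * Complex.log (-I * (z - a)) with hA
  set B : ℂ → ℂ := fun z => H z + ∑ a ∈ S, r a * Complex.log (I * (z - a)) with hB
  have hup : ∀ z ∈ R, (0 < z.im ∨ z.re = π ∨ z.re = -π) →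
      HasDerivAt (fun z => G z + I * A z) ((1 + I * Complex.tan (N * z / 2)) * g z) z ∧
      ContinuousAt (fun z => (1 + I * Complex.tan (N * z / 2)) * g z) z := by
    intro z hz hz'
    have hzS := hoff z (hz'.imp_left ne_of_gt)
    refine ⟨?_, (continuousAt_const.add (continuousAt_const.mul
      (htan z (hRV hz) hzS).continuousAt)).mul (hgd z (hRV hz)).continuousAt⟩
    have := (hG z (hRV hz)).add ((hprim (-I) (by simp) z (hRV hz) hzS ?_).const_mul I)
    · exact this.congr_deriv (by ring)
    · intro a ha
      obtain ⟨h0, h1, h2⟩ := hreal a ha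
      rw [mem_slitPlane_iff]
      simp only [neg_mul, neg_re, neg_im, I_mul_re, I_mul_im, sub_re, sub_im, h0]
      rcases hz' with h | h | h
      · left; linarith
      · right; exact ne_of_lt (by linarith)
      · right; exact ne_of_gt (by linarith)
  have hlo : ∀ z ∈ R, (z.im < 0 ∨ z.re = π ∨ z.re = -π) →
      HasDerivAt (fun z => G z - I * B z) ((1 - I * Complex.tan (N * z / 2)) * g z) z ∧
      ContinuousAt (fun z => (1 - I * Complex.tan (N * z / 2)) * g z) z := by
    intro z hz hz'
    have hzS := hoff z (hz'.imp_left ne_of_lt)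
    refine ⟨?_, (continuousAt_const.sub (continuousAt_const.mul
      (htan z (hRV hz) hzS).continuousAt)).mul (hgd z (hRV hz)).continuousAt⟩
    have := (hG z (hRV hz)).sub ((hprim I (by simp) z (hRV hz) hzS ?_).const_mul I)
    · exact this.congr_deriv (by ring)
    · intro a ha
      obtain ⟨h0, h1, h2⟩ := hreal a ha
      rw [mem_slitPlane_iff]
      simp only [I_mul_re, I_mul_im, sub_re, sub_im, h0]
      rcases hz' with h | h | h
      · left; linarith
      · right; exact ne_of_gt (by linarith)
      · right; exact ne_of_lt (by linarith)
  have hseg : ∀ {f F : ℂ → ℂ} {a b : ℂ} (P : ℂ → Prop),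
      (∀ z ∈ R, P z → HasDerivAt F (f z) z ∧ ContinuousAt f z) →
      (∀ s ∈ Icc (0 : ℝ) 1, a + s * (b - a) ∈ R ∧ P (a + s * (b - a))) →
      segIntegral f a b = F b - F a := fun P h hs =>
    segIntegral_eq_sub_of_hasDerivAt (fun s hs' => (h _ (hs s hs').1 (hs s hs').2).1)
      (fun s hs' => (h _ (hs s hs').1 (hs s hs').2).2)
  have hint : ∫ x in (-π : ℝ)..π, g (x : ℂ) = G π - G (-π) := by
    have hmem : ∀ x ∈ uIcc (-π) π, (x : ℂ) ∈ V := fun x hx => by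
      rw [uIcc_of_le (by linarith)] at hx
      refine hRV ?_
      simp only [hR, mem_ofPred_eq, ofReal_re, ofReal_im]
      exact ⟨hx.1, hx.2, by linarith, hγ0.le⟩
    rw [intervalIntegral.integral_eq_sub_of_hasDerivAt (f := fun x : ℝ => G x)
      (fun x hx => (hG x (hmem x hx)).comp_ofReal)]
    · simp
    · exact ContinuousOn.intervalIntegrable fun x hx =>
        ((hgd x (hmem x hx)).continuousAt.comp continuous_ofReal.continuousAt).continuousWithinAt
  have hres : (A π - A (-π)) - (B π - B (-π)) =
      2 * I * (2 * π / N * ∑ k ∈ Finset.Icc 1 N, g (θ k)) := by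
    have : (A π - A (-π)) - (B π - B (-π)) = ∑ a ∈ S, r a * -(2 * π * I) := by
      simp only [hA, hB]
      have e : ∀ x y s t u v : ℂ, (x + s - (y + t)) - (x + u - (y + v)) = s - t - (u - v) := by
        intros; ring
      rw [e, ← Finset.sum_sub_distrib, ← Finset.sum_sub_distrib, ← Finset.sum_sub_distrib]
      refine Finset.sum_congr rfl fun a ha => ?_
      obtain ⟨k, hk, rfl⟩ := Finset.mem_image.1 ha
      rw [← log_increment_sub_log_increment (hθmem k hk).1 (hθmem k hk).2]
      ring
    rw [this, hS, Finset.sum_image (fun i _ j _ h => hθinj h), Finset.mul_sum, Finset.mul_sum]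
    refine Finset.sum_congr rfl fun k _ => ?_
    simp only [hr]
    ring
  have hγm : ∀ s ∈ Icc (0 : ℝ) 1, 0 ≤ s * γ ∧ s * γ ≤ γ := fun s hs =>
    ⟨mul_nonneg hs.1 hγ0.le, mul_le_of_le_one_left hγ0.le hs.2⟩
  have hδm : ∀ s ∈ Icc (0 : ℝ) 1, 0 ≤ s * δ ∧ s * δ ≤ δ := fun s hs =>
    ⟨mul_nonneg hs.1 hδ0.le, mul_le_of_le_one_left hδ0.le hs.2⟩
  rw [hint, hseg _ hup, hseg _ hup, hseg _ hup, hseg _ hlo, hseg _ hlo, hseg _ hlo]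
  · linear_combination (-I / 2) * hres - (2 * π / N * ∑ k ∈ Finset.Icc 1 N, g (θ k)) * I_sq
  all_goals
    intro s hs
    have hγs := hγm s hs
    have hδs := hδm s hs
    have hπ₀ : 0 ≤ s * (π + π) := mul_nonneg hs.1 (by linarith)
    have hπ₁ : s * (π + π) ≤ π + π := mul_le_of_le_one_left (by linarith) hs.2
    simp [hR]
    first
    | exact ⟨⟨hπ₀, hπ₁, by linarith⟩, Or.inl ‹_›⟩
    | refine ⟨?_, ?_, ?_⟩ <;> linarith
end

section
/- Let c, d > 0 and let g be a complex-valued function analytic on an open subset of the complex plane containing the closed rectangle {θ ∈ ℂ : -π ≤ Re θ ≤ π, -δ ≤ Im θ ≤ γ}, where 0 < γ < c and 0 < δ < d. Let N be an odd positive integer and let θ_k = -π + (k - 1/2)(2π/N) for k = 1, …, N be the midpoint nodes. Then ∫_{-π}^{π} g(θ) dθ - (2π/N) Σ_{k=1}^{N} g(θ_k) = E₊(γ) + E₋(δ), where E₊(γ) = (1/2) [∫ from -π to -π+iγ + ∫ from -π+iγ to π+iγ + ∫ from π+iγ to π] of (1 - i·cot(Nθ/2)) g(θ) dθ, and E₋(δ)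 = (1/2) [∫ from -π to -π-iδ + ∫ from -π-iδ to π-iδ + ∫ from π-iδ to π] of (1 + i·cot(Nθ/2)) g(θ) dθ, all integrals being along straight line segments. -/
open Complex Real

section

open Set Filter Topology Asymptotics

theorem segIntegral_congr {f g : ℂ → ℂ} {a b : ℂ} (h : EqOn f g (segment ℝ a b)) :
    segIntegral f a b = segIntegral g a b := by
  unfold segIntegral
  congr 1
  refine intervalIntegral.integral_congr fun s hs => h ?_
  rw [uIcc_of_le zero_le_one] at hs
  rw [segment_eq_image']
  exact ⟨s, hs, by simp⟩

theorem ContinuousOn.comp_segment {f : ℂ → ℂ} {a b : ℂ} (hf : ContinuousOn f (segment ℝ a b)) :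
    ContinuousOn (fun s : ℝ => f (a + (s : ℂ) * (b - a))) (uIcc 0 1) := by
  refine hf.comp (by fun_prop) fun s hs => ?_
  rw [uIcc_of_le zero_le_one] at hs
  rw [segment_eq_image']
  exact ⟨s, hs, by simp⟩

theorem segIntegral_add {f g : ℂ → ℂ} {a b : ℂ} (hf : ContinuousOn f (segment ℝ a b))
    (hg : ContinuousOn g (segment ℝ a b)) :
    segIntegral (fun z => f z + g z) a b = segIntegral f a b + segIntegral g a b := by
  unfold segIntegral
  rw [intervalIntegral.integral_add hf.comp_segment.intervalIntegrable
    hg.comp_segment.intervalIntegrable, mul_add]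

theorem segIntegral_const_mul (c : ℂ) (f : ℂ → ℂ) (a b : ℂ) :
    segIntegral (fun z => c * f z) a b = c * segIntegral f a b := by
  unfold segIntegral
  rw [intervalIntegral.integral_const_mul]
  ring

theorem segIntegral_eq_sub {F f : ℂ → ℂ} {a b : ℂ}
    (hF : ∀ z ∈ segment ℝ a b, HasDerivAt F (f z) z) (hf : ContinuousOn f (segment ℝ a b)) :
    segIntegral f a b = F b - F a := by
  unfold segIntegral
  rw [← intervalIntegral.integral_const_mul]
  have key : ∀ s ∈ uIcc (0 : ℝ) 1, HasDerivAt (fun s : ℝ => F (a + (s : ℂ) * (b - a)))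
      ((b - a) * f (a + (s : ℂ) * (b - a))) s := by
    intro s hs
    rw [uIcc_of_le zero_le_one] at hs
    have hmem : a + (s : ℂ) * (b - a) ∈ segment ℝ a b := by
      rw [segment_eq_image']
      exact ⟨s, hs, by simp⟩
    have hl : HasDerivAt (fun s : ℝ => a + (s : ℂ) * (b - a)) (b - a) s := by
      simpa using ((ofRealCLM.hasDerivAt (x := s)).mul_const (b - a)).const_add a
    exact (hF _ hmem).scomp s hl
  rw [intervalIntegral.integral_eq_sub_of_hasDerivAt key
    (hf.comp_segment.intervalIntegrable.const_mul _)]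
  simp

theorem segIntegral_vertical (f : ℂ → ℂ) (x y₀ y₁ : ℝ) :
    segIntegral f (x + I * y₀) (x + I * y₁) = I * ∫ t in y₀..y₁, f (x + t * I) := by
  have h := intervalIntegral.smul_integral_comp_add_mul (a := 0) (b := 1)
    (fun t : ℝ => f (x + t * I)) (y₁ - y₀) y₀
  simp only [mul_zero, add_zero, mul_one, add_sub_cancel] at h
  rw [← h, segIntegral, Complex.real_smul]
  push_cast
  rw [show ((x : ℂ) + I * y₁ - (x + I * y₀)) = I * (y₁ - y₀) by ring, mul_assoc]
  have e (s : ℝ) : (x : ℂ) + I * y₀ + s * (I * (y₁ - y₀)) = x + (y₀ + (y₁ - y₀) * s) * I := by ring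
  simp only [e]

theorem segIntegral_horizontal (f : ℂ → ℂ) (x₀ x₁ y : ℝ) :
    segIntegral f (x₀ + I * y) (x₁ + I * y) = ∫ t in x₀..x₁, f (t + y * I) := by
  have h := intervalIntegral.smul_integral_comp_add_mul (a := 0) (b := 1)
    (fun t : ℝ => f (t + y * I)) (x₁ - x₀) x₀
  simp only [mul_zero, add_zero, mul_one, add_sub_cancel] at h
  rw [← h, segIntegral, Complex.real_smul]
  push_cast
  rw [show ((x₁ : ℂ) + I * y - (x₀ + I * y)) = (x₁ - x₀) by ring]
  congr! 4
  ring

/-- The integral of `f` along the three sides, other than the real one, of the rectangle with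
vertices `a`, `a + iy`, `b + iy`, `b`, from `a` to `b`. -/
noncomputable def archIntegral (f : ℂ → ℂ) (a b y : ℝ) : ℂ :=
  segIntegral f a (a + I * y) + segIntegral f (a + I * y) (b + I * y) +
    segIntegral f (b + I * y) b

/-- The path of integration of `archIntegral`. -/
def archPath (a b y : ℝ) : Set ℂ :=
  segment ℝ (a : ℂ) (a + I * y) ∪ segment ℝ (a + I * y : ℂ) (b + I * y) ∪
    segment ℝ (b + I * y : ℂ) b

theorem archPath_subset {a b y : ℝ} (hab : a ≤ b) :
    archPath a b y ⊆ {z | z.re ∈ Icc a b ∧ z.im ∈ uIcc 0 y ∧ (z.re = a ∨ z.re = b ∨ z.im = y)} := by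
  have hy : ∀ s ∈ Icc (0 : ℝ) 1, s * y ∈ uIcc 0 y := by
    intro s hs
    rw [mem_uIcc]
    rcases le_total 0 y with h | h
    · left; constructor <;> nlinarith [hs.1, hs.2]
    · right; constructor <;> nlinarith [hs.1, hs.2]
  rintro z ((hz | hz) | hz) <;> rw [segment_eq_image'] at hz <;> obtain ⟨s, hs, rfl⟩ := hz
  · simpa [hab] using hy s hs
  · simp only [mem_ofPred_eq, mem_Icc]
    refine ⟨⟨?_, ?_⟩, ?_, ?_⟩ <;> simp
    · nlinarith [hs.1, hs.2]
    · nlinarith [hs.1, hs.2]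
  · have := hy (1 - s) ⟨by linarith [hs.2], by linarith [hs.1]⟩
    simp [hab]
    convert this using 1
    ring

theorem archIntegral_congr {f g : ℂ → ℂ} {a b y : ℝ} (h : EqOn f g (archPath a b y)) :
    archIntegral f a b y = archIntegral g a b y := by
  unfold archIntegral
  rw [segIntegral_congr (h.mono fun z hz => .inl (.inl hz)),
    segIntegral_congr (h.mono fun z hz => .inl (.inr hz)),
    segIntegral_congr (h.mono fun z hz => .inr hz)]

theorem archIntegral_add {f g : ℂ → ℂ} {a b y : ℝ} (hf : ContinuousOn f (archPath a b y))
    (hg : ContinuousOn g (archPath a b y)) :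
    archIntegral (fun z => f z + g z) a b y = archIntegral f a b y + archIntegral g a b y := by
  unfold archIntegral
  rw [segIntegral_add (hf.mono fun z hz => .inl (.inl hz)) (hg.mono fun z hz => .inl (.inl hz)),
    segIntegral_add (hf.mono fun z hz => .inl (.inr hz)) (hg.mono fun z hz => .inl (.inr hz)),
    segIntegral_add (hf.mono fun z hz => .inr hz) (hg.mono fun z hz => .inr hz)]
  ring

theorem archIntegral_const_mul (c : ℂ) (f : ℂ → ℂ) (a b y : ℝ) :
    archIntegral (fun z => c * f z) a b y = c * archIntegral f a b y := by
  simp only [archIntegral, segIntegral_const_mul]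
  ring

theorem archIntegral_eq_sub {F f : ℂ → ℂ} {a b y : ℝ}
    (hF : ∀ z ∈ archPath a b y, HasDerivAt F (f z) z) (hf : ContinuousOn f (archPath a b y)) :
    archIntegral f a b y = F b - F a := by
  unfold archIntegral
  rw [segIntegral_eq_sub (fun z hz => hF z (.inl (.inl hz))) (hf.mono fun z hz => .inl (.inl hz)),
    segIntegral_eq_sub (fun z hz => hF z (.inl (.inr hz))) (hf.mono fun z hz => .inl (.inr hz)),
    segIntegral_eq_sub (fun z hz => hF z (.inr hz)) (hf.mono fun z hz => .inr hz)]
  ring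

/-- Cauchy's theorem for the rectangle between the real segment and the arch. -/
theorem archIntegral_eq_integral {f : ℂ → ℂ} {a b y : ℝ}
    (hf : DifferentiableOn ℂ f (uIcc a b ×ℂ uIcc 0 y)) :
    archIntegral f a b y = ∫ x in a..b, f x := by
  have h := integral_boundary_rect_eq_zero_of_differentiableOn f (a : ℂ) (b + I * y)
    (by simpa using hf)
  have h₁ := segIntegral_vertical f a 0 y
  have h₂ := segIntegral_vertical f b y 0
  rw [intervalIntegral.integral_symm] at h₂
  simp only [ofReal_zero, mul_zero, add_zero] at h₁ h₂
  rw [archIntegral, h₁, h₂, segIntegral_horizontal]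
  simp at h
  linear_combination -h

theorem archIntegral_inv_sub {a b y p : ℝ} (hp : p ∈ Ioo a b) (σ : ℝ) (hσ : 0 < σ * y) :
    archIntegral (fun z => (z - p)⁻¹) a b y =
      Complex.log (-(σ * I) * (b - p)) - Complex.log (-(σ * I) * (a - p)) := by
  have hσ0 : σ ≠ 0 := by rintro rfl; simp at hσ
  have hmem : ∀ z ∈ archPath a b y, -(σ * I) * (z - p) ∈ slitPlane := by
    intro z hz
    obtain ⟨-, him, h⟩ := archPath_subset (hp.1.trans hp.2).le hz
    rw [mem_slitPlane_iff]
    simp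
    rcases h with h | h | h
    · right; exact ⟨hσ0, by rw [h]; linarith [hp.1]⟩
    · right; exact ⟨hσ0, by rw [h]; linarith [hp.2]⟩
    · left; rwa [h]
  have hne : ∀ z ∈ archPath a b y, z - p ≠ 0 := fun z hz h0 => by
    simpa [h0] using hmem z hz
  rw [archIntegral_eq_sub (F := fun z => Complex.log (-(σ * I) * (z - p)))]
  · intro z hz
    have := ((((hasDerivAt_id' z).sub_const (p : ℂ)).const_mul (-(σ * I : ℂ))).clog (hmem z hz))
    convert this using 1
    have : (σ : ℂ) ≠ 0 := by exact_mod_cast hσ0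
    have := hne z hz
    simp
    field_simp
  · exact (continuousOn_id.sub continuousOn_const).inv₀ hne

theorem archIntegral_inv_sub_sub {a b y₁ y₂ p : ℝ} (hp : p ∈ Ioo a b) (hy₁ : y₁ < 0)
    (hy₂ : 0 < y₂) :
    archIntegral (fun z => (z - p)⁻¹) a b y₂ - archIntegral (fun z => (z - p)⁻¹) a b y₁ =
      -(2 * π * I) := by
  rw [archIntegral_inv_sub hp 1 (by linarith), archIntegral_inv_sub hp (-1) (by linarith)]
  have hb : 0 < b - p := by linarith [hp.2]
  have ha : 0 < p - a := by linarith [hp.1]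
  have e₁ := log_ofReal_mul hb (neg_ne_zero.2 I_ne_zero)
  have e₂ := log_ofReal_mul ha I_ne_zero
  have e₃ := log_ofReal_mul hb I_ne_zero
  have e₄ := log_ofReal_mul ha (neg_ne_zero.2 I_ne_zero)
  rw [log_I] at e₂ e₃
  rw [log_neg_I] at e₁ e₄
  push_cast at e₁ e₂ e₃ e₄ ⊢
  rw [show -(1 * I) * ((b : ℂ) - p) = (b - p) * -I by ring,
    show -(1 * I) * ((a : ℂ) - p) = (p - a) * I by ring,
    show -(-1 * I) * ((b : ℂ) - p) = (b - p) * I by ring,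
    show -(-1 * I) * ((a : ℂ) - p) = (p - a) * -I by ring, e₁, e₂, e₃, e₄]
  ring

theorem archPath_subset_sdiff {a b y₁ y₂ y : ℝ} {U : Set ℂ} (hab : a < b) (hy : y ≠ 0)
    (hyy : uIcc 0 y ⊆ Icc y₁ y₂) (hU : Icc a b ×ℂ Icc y₁ y₂ ⊆ U) {S : Finset ℝ}
    (hS : ∀ p ∈ S, p ∈ Ioo a b) :
    archPath a b y ⊆ U \ ((↑) '' (S : Set ℝ)) := by
  intro z hz
  obtain ⟨hre, him, h⟩ := archPath_subset hab.le hz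
  refine ⟨hU ⟨hre, hyy him⟩, ?_⟩
  rintro ⟨p, hp, rfl⟩
  have := hS p hp
  simp at h
  rcases h with h | h | h
  · exact this.1.ne' h
  · exact this.2.ne h
  · exact hy h.symm

/-- Residue theorem for a rectangle and finitely many simple poles on the real axis. -/
theorem archIntegral_sub_archIntegral_eq_sum {a b y₁ y₂ : ℝ} (hab : a < b) (hy₁ : y₁ < 0)
    (hy₂ : 0 < y₂) {U : Set ℂ} (hUo : IsOpen U) (hU : Icc a b ×ℂ Icc y₁ y₂ ⊆ U)
    (S : Finset ℝ) (hS : ∀ p ∈ S, p ∈ Ioo a b) (r : ℝ → ℂ) (f : ℂ → ℂ)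
    (hf : DifferentiableOn ℂ f (U \ ((↑) '' (S : Set ℝ))))
    (hr : ∀ p ∈ S, Tendsto (fun z : ℂ => (z - p) * f z) (𝓝[≠] (p : ℂ)) (𝓝 (r p))) :
    archIntegral f a b y₂ - archIntegral f a b y₁ = -(2 * π * I) * ∑ p ∈ S, r p := by
  have hy₁' : uIcc 0 y₁ ⊆ Icc y₁ y₂ := by
    rw [uIcc_of_ge hy₁.le]; exact Icc_subset_Icc_right hy₂.le
  have hy₂' : uIcc 0 y₂ ⊆ Icc y₁ y₂ := by
    rw [uIcc_of_le hy₂.le]; exact Icc_subset_Icc_left hy₁.le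
  induction S using Finset.induction_on generalizing f with
  | empty =>
    simp only [Finset.coe_empty, image_empty, sdiff_empty] at hf
    rw [archIntegral_eq_integral, archIntegral_eq_integral]
    · simp
    · exact hf.mono ((reProdIm_subset_iff.2
        (prod_mono (by rw [uIcc_of_le hab.le]) hy₁')).trans hU)
    · exact hf.mono ((reProdIm_subset_iff.2
        (prod_mono (by rw [uIcc_of_le hab.le]) hy₂')).trans hU)
  | insert p S hpS ih =>
    have hSo : IsClosed ((↑) '' (S : Set ℝ) : Set ℂ) := (S.finite_toSet.image _).isClosed
    have hpI : p ∈ Ioo a b := hS p (Finset.mem_insert_self _ _)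
    have hpU : (p : ℂ) ∈ U \ ((↑) '' (S : Set ℝ)) :=
      ⟨hU ⟨by simpa using ⟨hpI.1.le, hpI.2.le⟩, by simpa using ⟨hy₁.le, hy₂.le⟩⟩, by simpa using hpS⟩
    have hset : U \ ((↑) '' ((insert p S : Finset ℝ) : Set ℝ)) =
        (U \ ((↑) '' (S : Set ℝ))) \ {(p : ℂ)} := by
      rw [Finset.coe_insert, image_insert_eq, Set.sdiff_sdiff, union_singleton]
    set f₁ : ℂ → ℂ := fun z => f z - r p * (z - p)⁻¹ with hf₁
    have hinv : DifferentiableOn ℂ (fun z : ℂ => (z - p)⁻¹) {(p : ℂ)}ᶜ := fun z hz =>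
      ((differentiableAt_id.sub_const (p : ℂ)).fun_inv (sub_ne_zero.2 hz)).differentiableWithinAt
    have hd₁ : DifferentiableOn ℂ f₁ ((U \ ((↑) '' (S : Set ℝ))) \ {(p : ℂ)}) := by
      rw [hset] at hf
      exact hf.sub ((hinv.mono fun z hz => hz.2).const_mul _)
    have ho : (fun z => f₁ z - f₁ p) =o[𝓝[≠] (p : ℂ)] fun z => (z - p)⁻¹ := by
      rw [isLittleO_iff_tendsto']
      · have h0 : Tendsto (fun z : ℂ => z - p) (𝓝[≠] (p : ℂ)) (𝓝 0) := by
          have : Tendsto (fun z : ℂ => z - p) (𝓝 (p : ℂ)) (𝓝 (p - p)) :=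
            (continuous_id.sub continuous_const).tendsto _
          rw [sub_self] at this
          exact this.mono_left nhdsWithin_le_nhds
        have h1 := ((hr p (Finset.mem_insert_self _ _)).sub_const (r p)).sub (h0.mul_const (f₁ p))
        simp only [sub_self, zero_mul] at h1
        refine h1.congr' ?_
        filter_upwards [self_mem_nhdsWithin] with z hz
        have : z - p ≠ 0 := sub_ne_zero.2 hz
        simp only [hf₁]
        field_simp
      · filter_upwards [self_mem_nhdsWithin] with z hz h
        exact absurd h (inv_ne_zero (sub_ne_zero.2 hz))
    set f₂ := Function.update f₁ p (limUnder (𝓝[≠] (p : ℂ)) f₁) with hf₂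
    have hd₂ : DifferentiableOn ℂ f₂ (U \ ((↑) '' (S : Set ℝ))) :=
      differentiableOn_update_limUnder_of_isLittleO
        ((hUo.sdiff hSo).mem_nhds hpU) hd₁ ho
    have heq : ∀ z : ℂ, z ≠ p → f z = f₂ z + r p * (z - p)⁻¹ := fun z hz => by
      rw [hf₂, Function.update_of_ne hz, hf₁]; ring
    have key := ih (fun q hq => hS q (Finset.mem_insert_of_mem hq)) f₂ hd₂ fun q hq => by
      have hqp : (q : ℂ) ≠ p := by
        rw [Ne, ofReal_inj]; rintro rfl; exact hpS hq
      have h1 : Tendsto (fun z : ℂ => (z - q) * (r p * (z - p)⁻¹)) (𝓝[≠] (q : ℂ)) (𝓝 0) := by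
        have : ContinuousAt (fun z : ℂ => (z - q) * (r p * (z - p)⁻¹)) q := by
          have := sub_ne_zero.2 hqp
          fun_prop (disch := assumption)
        have := this.tendsto
        simp only [sub_self, zero_mul] at this
        exact this.mono_left nhdsWithin_le_nhds
      have h2 := (hr q (Finset.mem_insert_of_mem hq)).sub h1
      rw [sub_zero] at h2
      refine h2.congr' ?_
      filter_upwards [nhdsWithin_le_nhds (isOpen_ne.mem_nhds hqp)] with z hz
      rw [heq z hz]
      ring
    have harch : ∀ y : ℝ, y ≠ 0 → uIcc 0 y ⊆ Icc y₁ y₂ → archIntegral f a b y =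
        archIntegral f₂ a b y + r p * archIntegral (fun z => (z - p)⁻¹) a b y := by
      intro y hy hyy
      have hsub := archPath_subset_sdiff hab hy hyy hU hS
      rw [hset] at hsub
      rw [archIntegral_congr (fun z hz => heq z (hsub hz).2), archIntegral_add
        (hd₂.continuousOn.mono fun z hz => (hsub hz).1)
        ((hinv.continuousOn.mono fun z hz => (hsub hz).2).const_mul _), archIntegral_const_mul]
    rw [harch y₁ hy₁.ne hy₁', harch y₂ hy₂.ne' hy₂', Finset.sum_insert hpS]
    linear_combination key + r p * archIntegral_inv_sub_sub hpI hy₁ hy₂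

theorem tendsto_sub_mul_cot_mul {g : ℂ → ℂ} {w p : ℂ} (hw : w ≠ 0) (hg : ContinuousAt g p)
    (hp : Complex.sin (w * p) = 0) :
    Tendsto (fun z => (z - p) * (Complex.cot (w * z) * g z)) (𝓝[≠] p) (𝓝 (w⁻¹ * g p)) := by
  have hcos : Complex.cos (w * p) ≠ 0 := fun h => by
    simpa [h, hp] using Complex.sin_sq_add_cos_sq (w * p)
  have hd : HasDerivAt (fun z => Complex.sin (w * z)) (Complex.cos (w * p) * w) p := by
    simpa using ((hasDerivAt_id' p).const_mul w).csin
  have hs := (hasDerivAt_iff_tendsto_slope.1 hd).inv₀ (mul_ne_zero hcos hw)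
  have hc : Tendsto (fun z => Complex.cos (w * z) * g z) (𝓝[≠] p)
      (𝓝 (Complex.cos (w * p) * g p)) := by
    have : ContinuousAt (fun z => Complex.cos (w * z) * g z) p := by fun_prop
    exact this.tendsto.mono_left nhdsWithin_le_nhds
  convert hs.mul hc using 2 with z
  · rw [slope_def_field, hp, sub_zero, inv_div, Complex.cot]
    ring
  · field_simp

/-- The `k`-th node of the midpoint rule with `N` panels on `[-π, π]`. -/
noncomputable def midpointNode (N k : ℕ) : ℝ := -π + ((k : ℝ) - 1/2) * (2 * π / N)

theorem midpointNode_mem_Ioo {N k : ℕ} (hk : k ∈ Finset.Icc 1 N) :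
    midpointNode N k ∈ Ioo (-π) π := by
  rw [Finset.mem_Icc] at hk
  have h1 : (1 : ℝ) ≤ k := by exact_mod_cast hk.1
  have h2 : (k : ℝ) ≤ N := by exact_mod_cast hk.2
  have hN : (0 : ℝ) < N := by linarith
  have hh : 0 < 2 * π / N := by positivity
  have hNh : N * (2 * π / N) = 2 * π := by field_simp
  unfold midpointNode
  constructor <;> nlinarith

theorem midpointNode_injective {N : ℕ} (hN : 0 < N) : Function.Injective (midpointNode N) := by
  intro j k h
  have hh : 2 * π / N ≠ 0 := by positivity
  simpa [midpointNode, hh] using h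

theorem sin_mul_midpointNode {N : ℕ} (hN : Odd N) (k : ℕ) :
    Complex.sin ((N : ℂ) / 2 * midpointNode N k) = 0 := by
  obtain ⟨m, rfl⟩ := hN
  rw [Complex.sin_eq_zero_iff]
  refine ⟨k - m - 1, ?_⟩
  have : (2 * (m : ℂ) + 1) ≠ 0 := by exact_mod_cast (2 * m).succ_ne_zero
  unfold midpointNode
  push_cast
  field_simp
  ring

theorem exists_midpointNode_of_sin_eq_zero {N : ℕ} (hN : Odd N) {z : ℂ} (hz : z.re ∈ Icc (-π) π)
    (h : Complex.sin ((N : ℂ) / 2 * z) = 0) :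
    ∃ k ∈ Finset.Icc 1 N, (midpointNode N k : ℂ) = z := by
  obtain ⟨m, rfl⟩ := hN
  obtain ⟨j, hj⟩ := Complex.sin_eq_zero_iff.1 h
  have hne : (2 * (m : ℂ) + 1) ≠ 0 := by exact_mod_cast (2 * m).succ_ne_zero
  have hz' : (2 * (m : ℂ) + 1) * z = 2 * j * π := by
    push_cast at hj
    linear_combination 2 * hj
  have hre : (2 * (m : ℝ) + 1) * z.re = 2 * j * π := by
    have := congrArg Complex.re hz'
    rw [show (2 * (m : ℂ) + 1) = ((2 * m + 1 : ℝ) : ℂ) by push_cast; ring,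
      show (2 * (j : ℂ) * π) = ((2 * j * π : ℝ) : ℂ) by push_cast; ring] at this
    rwa [re_ofReal_mul, ofReal_re] at this
  have hm : (0 : ℝ) ≤ m := m.cast_nonneg
  have h1 : 2 * j ≤ 2 * m + 1 := by
    have : (2 * j : ℝ) * π ≤ (2 * m + 1) * π := by rw [← hre]; gcongr; exact hz.2
    exact_mod_cast le_of_mul_le_mul_right this pi_pos
  have h2 : -(2 * m + 1) ≤ 2 * j := by
    have : (-(2 * m + 1) : ℝ) * π ≤ (2 * j) * π := by rw [← hre]; nlinarith [hz.1]
    exact_mod_cast le_of_mul_le_mul_right this pi_pos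
  refine ⟨(j + m + 1).toNat, ?_, ?_⟩
  · rw [Finset.mem_Icc]; omega
  · have hk : (((j + m + 1).toNat : ℕ) : ℂ) = j + m + 1 := by
      rw [← Int.cast_natCast, Int.toNat_of_nonneg (by omega)]
      push_cast; ring
    unfold midpointNode
    push_cast
    rw [hk]
    apply mul_left_cancel₀ hne
    rw [hz']
    field_simp
    ring

theorem integral_sub_midpoint_sum_eq_archIntegral {γ δ : ℝ} (hγ : 0 < γ) (hδ : 0 < δ)
    {g : ℂ → ℂ} {U : Set ℂ} (hUo : IsOpen U) (hU : Icc (-π) π ×ℂ Icc (-δ) γ ⊆ U)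
    (hg : DifferentiableOn ℂ g U) {N : ℕ} (hN : Odd N) :
    (∫ x in (-π : ℝ)..π, g (x : ℂ)) -
      (2 * π / N) * ∑ k ∈ Finset.Icc 1 N, g (midpointNode N k) =
    (1/2) * archIntegral (fun θ => (1 - I * Complex.cot (N * θ / 2)) * g θ) (-π) π γ
    + (1/2) * archIntegral (fun θ => (1 + I * Complex.cot (N * θ / 2)) * g θ) (-π) π (-δ) := by
  have hNpos : 0 < N := hN.pos
  set S : Finset ℝ := (Finset.Icc 1 N).image (midpointNode N) with hSdef
  have hS : ∀ p ∈ S, p ∈ Ioo (-π) π := by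
    intro p hp
    obtain ⟨k, hk, rfl⟩ := Finset.mem_image.1 hp
    exact midpointNode_mem_Ioo hk
  have hπ : -π < π := by linarith [pi_pos]
  have hN0 : (N : ℂ) ≠ 0 := by exact_mod_cast hNpos.ne'
  have hyδ : uIcc 0 (-δ) ⊆ Icc (-δ) γ := by
    rw [uIcc_of_ge (by linarith)]; exact Icc_subset_Icc_right hγ.le
  have hyγ : uIcc 0 γ ⊆ Icc (-δ) γ := by
    rw [uIcc_of_le hγ.le]; exact Icc_subset_Icc_left (by linarith)
  have hsin : ∀ z : ℂ, z.re ∈ Icc (-π) π → z ∉ ((↑) '' (S : Set ℝ) : Set ℂ) →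
      Complex.sin ((N : ℂ) / 2 * z) ≠ 0 := by
    intro z hz hzS h
    obtain ⟨k, hk, rfl⟩ := exists_midpointNode_of_sin_eq_zero hN hz h
    exact hzS ⟨_, Finset.mem_image_of_mem _ hk, rfl⟩
  set V : Set ℂ := U ∩ ({z | Complex.sin ((N : ℂ) / 2 * z) ≠ 0} ∪ re ⁻¹' Ioo (-π) π) with hV
  have hVo : IsOpen V := hUo.inter <|
    (isOpen_ne_fun (by fun_prop) continuous_const).union (isOpen_Ioo.preimage continuous_re)
  have hRV : Icc (-π) π ×ℂ Icc (-δ) γ ⊆ V := by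
    intro z hz
    refine ⟨hU hz, ?_⟩
    by_cases hzS : z ∈ ((↑) '' (S : Set ℝ) : Set ℂ)
    · obtain ⟨p, hp, rfl⟩ := hzS
      exact .inr (hS p hp)
    · exact .inl (hsin z hz.1 hzS)
  have hf : DifferentiableOn ℂ (fun z => Complex.cot ((N : ℂ) / 2 * z) * g z)
      (V \ ((↑) '' (S : Set ℝ))) := by
    intro z hz
    have hs : Complex.sin ((N : ℂ) / 2 * z) ≠ 0 :=
      hz.1.2.elim id fun h => hsin z (Ioo_subset_Icc_self h) hz.2
    have hgz : DifferentiableAt ℂ g z := hg.differentiableAt (hUo.mem_nhds hz.1.1)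
    unfold Complex.cot
    exact DifferentiableAt.differentiableWithinAt (by fun_prop (disch := assumption))
  have hres := archIntegral_sub_archIntegral_eq_sum hπ (neg_lt_zero.2 hδ) hγ hVo hRV S hS
    (fun p => ((N : ℂ) / 2)⁻¹ * g p) _ hf fun p hp => by
      obtain ⟨k, hk, rfl⟩ := Finset.mem_image.1 hp
      refine tendsto_sub_mul_cot_mul (by simpa using hN0) ?_ (sin_mul_midpointNode hN k)
      have hk := midpointNode_mem_Ioo hk
      refine (hg.differentiableAt (hUo.mem_nhds (hU ⟨?_, ?_⟩))).continuousAt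
      · simpa using ⟨hk.1.le, hk.2.le⟩
      · simpa using ⟨hδ.le, hγ.le⟩
  rw [hSdef, Finset.sum_image (midpointNode_injective hNpos).injOn, ← Finset.mul_sum] at hres
  have hsplit : ∀ (c : ℂ) (y : ℝ), y ≠ 0 → uIcc 0 y ⊆ Icc (-δ) γ →
      archIntegral (fun θ => (1 + c * Complex.cot (N * θ / 2)) * g θ) (-π) π y =
        (∫ x in (-π : ℝ)..π, g (x : ℂ)) +
          c * archIntegral (fun z => Complex.cot ((N : ℂ) / 2 * z) * g z) (-π) π y := by
    intro c y hy hyy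
    have hsub := archPath_subset_sdiff hπ hy hyy hRV hS
    rw [← archIntegral_const_mul, ← archIntegral_eq_integral (y := y), ← archIntegral_add]
    · congr 1
      ext z
      rw [mul_div_right_comm]
      ring
    · exact hg.continuousOn.mono fun z hz => (hsub hz).1.1
    · exact (hf.continuousOn.mono hsub).const_mul _
    · exact hg.mono ((reProdIm_subset_iff.2
        (prod_mono (by rw [uIcc_of_le hπ.le]) hyy)).trans hU)
  have h₁ := hsplit (-I) γ hγ.ne' hyγ
  have h₂ := hsplit I (-δ) (neg_ne_zero.2 hδ.ne') hyδ
  simp only [neg_mul, ← sub_eq_add_neg] at h₁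
  rw [h₁, h₂]
  rw [inv_div] at hres
  linear_combination (I / 2) * hres -
    (π * (2 / N) * ∑ k ∈ Finset.Icc 1 N, g (midpointNode N k)) * I_sq

end

/-- **Midpoint rule error formula, odd case.**
If `g` is analytic on an open set containing the closed rectangle
`[-π, π] × [-δ, γ]` (with `0 < γ < c`, `0 < δ < d`), and `N` is an odd positive
integer, then the midpoint rule error equals `E₊(γ) + E₋(δ)`, where the error
integrals involve the kernels `1 ∓ i·cot(Nθ/2)` along the indicated segments. -/
theorem midpoint_error_formula_odd
    (c d : ℝ) (hc : 0 < c) (hd : 0 < d) (γ δ : ℝ)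
    (hγ0 : 0 < γ) (hγc : γ < c) (hδ0 : 0 < δ) (hδd : δ < d)
    (g : ℂ → ℂ) (U : Set ℂ) (hU : IsOpen U)
    (hrect : {θ : ℂ | -π ≤ θ.re ∧ θ.re ≤ π ∧ -δ ≤ θ.im ∧ θ.im ≤ γ} ⊆ U)
    (hg : ∀ z ∈ U, AnalyticAt ℂ g z)
    (N : ℕ) (hN : 0 < N) (hNodd : Odd N) :
    (∫ x in (-π : ℝ)..π, g (x : ℂ)) -
      (2 * π / N) * ∑ k ∈ Finset.Icc 1 N, g ((-π + ((k : ℝ) - 1/2) * (2 * π / N) : ℝ) : ℂ) =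
    (1/2) * (segIntegral (fun θ => (1 - I * Complex.cot (N * θ / 2)) * g θ)
                (-(π:ℂ)) (-(π:ℂ) + I * γ)
            + segIntegral (fun θ => (1 - I * Complex.cot (N * θ / 2)) * g θ)
                (-(π:ℂ) + I * γ) ((π:ℂ) + I * γ)
            + segIntegral (fun θ => (1 - I * Complex.cot (N * θ / 2)) * g θ)
                ((π:ℂ) + I * γ) (π:ℂ))
    + (1/2) * (segIntegral (fun θ => (1 + I * Complex.cot (N * θ / 2)) * g θ)
                (-(π:ℂ)) (-(π:ℂ) - I * δ)
            + segIntegral (fun θ => (1 + I * Complex.cot (N * θ / 2)) * g θ)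
                (-(π:ℂ) - I * δ) ((π:ℂ) - I * δ)
            + segIntegral (fun θ => (1 + I * Complex.cot (N * θ / 2)) * g θ)
                ((π:ℂ) - I * δ) (π:ℂ)) := by
  have h := integral_sub_midpoint_sum_eq_archIntegral hγ0 hδ0 hU
    (fun z hz => hrect ⟨hz.1.1, hz.1.2, hz.2.1, hz.2.2⟩)
    (fun z hz => (hg z hz).differentiableAt.differentiableWithinAt) hNodd
  simpa only [midpointNode, archIntegral, ofReal_neg, mul_neg, ← sub_eq_add_neg] using h
end

section
/- Let γ₀ > 0 and let g be a complex-valued function analytic on an open subset of ℂ containing the closed horizontal strip {θ ∈ ℂ : |Im θ| ≤ γ}, for some 0 < γ < γ₀, such that g is 2π-periodic (g(θ + 2π) = g(θ) on the strip) and real-valued on the real axis. Let N be an even positive integer and θ_k = -π + (k - 1/2)(2π/N), k = 1, …, N, the midpoint nodes. Then ∫_{-π}^{π} g(θ) dθ - (2π/N) Σ_{k=1}^{N} g(θ_k) = Re ∫ along the straight segment from -π+iγ to π+iγ of (1 + i·tan(Nθ/2)) g(θ) dθ. -/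
open Complex Real

open Filter Topology Set

/-- The quotient `a / b`, extended by `deriv a z / deriv b z` at the zeros `z` of `b`. -/
noncomputable def lhopitalDiv (a b : ℂ → ℂ) (z : ℂ) : ℂ :=
  if b z = 0 then deriv a z / deriv b z else a z / b z

theorem AnalyticAt.dslope_self {f : ℂ → ℂ} {z : ℂ} (hf : AnalyticAt ℂ f z) :
    AnalyticAt ℂ (dslope f z) z := by
  obtain ⟨p, hp⟩ := hf
  exact hp.has_fpower_series_dslope_fslope.analyticAt

theorem differentiableAt_lhopitalDiv {a b : ℂ → ℂ} {z : ℂ} (ha : AnalyticAt ℂ a z)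
    (hb : AnalyticAt ℂ b z) (h : b z = 0 → a z = 0 ∧ deriv b z ≠ 0) :
    DifferentiableAt ℂ (lhopitalDiv a b) z := by
  by_cases hz : b z = 0
  · obtain ⟨haz, hdz⟩ := h hz
    have hb' : dslope b z z ≠ 0 := by rwa [dslope_same]
    have heq : lhopitalDiv a b =ᶠ[𝓝 z] fun w => dslope a z w / dslope b z w := by
      filter_upwards [hb.dslope_self.continuousAt.eventually_ne hb'] with w hw
      rcases eq_or_ne w z with rfl | hwz
      · simp [lhopitalDiv, hz]
      · have hwz' : w - z ≠ 0 := sub_ne_zero.2 hwz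
        rw [dslope_of_ne _ hwz, slope_def_field, hz, sub_zero] at hw
        have hbw : b w ≠ 0 := fun h0 => hw (by simp [h0])
        rw [dslope_of_ne _ hwz, dslope_of_ne _ hwz, slope_def_field, slope_def_field, hz, haz]
        simp only [lhopitalDiv, hbw, if_false, sub_zero]
        field_simp
    exact (ha.dslope_self.differentiableAt.div hb.dslope_self.differentiableAt
      hb').congr_of_eventuallyEq heq
  · have heq : lhopitalDiv a b =ᶠ[𝓝 z] fun w => a w / b w := by
      filter_upwards [hb.continuousAt.eventually_ne hz] with w hw
      simp [lhopitalDiv, hw]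
    exact (ha.differentiableAt.div hb.differentiableAt hz).congr_of_eventuallyEq heq

theorem integral_horizontal_eq_of_periodic {f : ℂ → ℂ} {γ : ℝ}
    (hf : ∀ z : ℂ, |z.im| ≤ γ → DifferentiableAt ℂ f z)
    (hper : ∀ y : ℝ, |y| ≤ γ → f (π + y * I) = f ((-π : ℝ) + y * I))
    {y₁ y₂ : ℝ} (h₁ : |y₁| ≤ γ) (h₂ : |y₂| ≤ γ) :
    ∫ x in (-π)..π, f (x + y₁ * I) = ∫ x in (-π)..π, f (x + y₂ * I) := by
  have hmem : ∀ y ∈ uIcc y₁ y₂, |y| ≤ γ := fun y hy =>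
    abs_le.2 (uIcc_subset_Icc (abs_le.1 h₁) (abs_le.1 h₂) hy)
  have key := integral_boundary_rect_eq_zero_of_differentiableOn f
    ((-π : ℝ) + y₁ * I) (π + y₂ * I)
    fun z hz => (hf z (hmem _ (by simpa using hz.2))).differentiableWithinAt
  have hv : ∫ y in y₁..y₂, f (π + y * I) = ∫ y in y₁..y₂, f ((-π : ℝ) + y * I) :=
    intervalIntegral.integral_congr fun y hy => hper y (hmem y hy)
  simp only [add_re, add_im, mul_re, mul_im, ofReal_re, ofReal_im, I_re, I_im, mul_zero, mul_one,
    add_zero, zero_add, sub_self] at key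
  rw [hv, add_sub_cancel_right, sub_eq_zero] at key
  exact key

theorem cos_nat_mul_half_ne_zero {N : ℕ} (hN : 0 < N) {z : ℂ} (hz : z.im ≠ 0) :
    Complex.cos (N * z / 2) ≠ 0 := by
  rw [Ne, Complex.cos_eq_zero_iff]
  rintro ⟨k, hk⟩
  have h := congrArg Complex.im hk
  have e1 : (N * z / 2).im = N * z.im / 2 := by
    simp [Complex.div_ofNat_im, mul_im]
  have e2 : ((2 * (k : ℂ) + 1) * π / 2).im = 0 := by
    simp [Complex.div_ofNat_im, mul_im]
  rw [e1, e2] at h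
  have hN' : (N : ℝ) ≠ 0 := by positivity
  have : (N : ℝ) * z.im ≠ 0 := mul_ne_zero hN' hz
  apply this; linarith

theorem cos_nat_mul_half_ne_zero_of_even {N : ℕ} (hN : Even N) (y : ℝ) :
    Complex.cos (N * (π + y * I) / 2) ≠ 0 := by
  rw [Ne, Complex.cos_eq_zero_iff]
  rintro ⟨k, hk⟩
  have h := congrArg Complex.re hk
  have e1 : (N * (π + y * I) / 2).re = N * π / 2 := by
    simp [Complex.div_ofNat_re, mul_re]
  have e2 : ((2 * (k : ℂ) + 1) * π / 2).re = (2 * k + 1) * π / 2 := by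
    simp [Complex.div_ofNat_re, mul_re]
  rw [e1, e2] at h
  have h' : (N : ℝ) = 2 * k + 1 := by
    have := Real.pi_pos
    apply mul_right_cancel₀ this.ne'
    linarith
  have h'' : (N : ℤ) = 2 * k + 1 := by exact_mod_cast h'
  obtain ⟨m, rfl⟩ := hN
  push_cast at h''
  omega

theorem continuous_tan_horizontal {N : ℕ} (hN : 0 < N) {y : ℝ} (hy : y ≠ 0) :
    Continuous fun x : ℝ => Complex.tan (N * (x + y * I) / 2) := by
  refine continuous_iff_continuousAt.2 fun x => ?_
  have hc : Complex.cos (N * (x + y * I) / 2) ≠ 0 :=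
    cos_nat_mul_half_ne_zero hN (by simpa using hy)
  exact ContinuousAt.comp (f := fun x : ℝ => (N * (x + y * I) / 2 : ℂ))
    (Complex.continuousAt_tan.2 hc) (by fun_prop)

theorem continuous_comp_horizontal {f : ℂ → ℂ} {γ y : ℝ} (hy : |y| ≤ γ)
    (hf : AnalyticOnNhd ℂ f {z | |z.im| ≤ γ}) : Continuous fun x : ℝ => f (x + y * I) := by
  refine continuous_iff_continuousAt.2 fun x => ?_
  exact ContinuousAt.comp (f := fun x : ℝ => (x + y * I : ℂ))
    (hf _ (by simpa using hy)).continuousAt (by fun_prop)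

theorem tan_nat_mul_half_add (N : ℕ) (hN : 0 < N) (z : ℂ) :
    Complex.tan (N * (z + 2 * π / N) / 2) = Complex.tan (N * z / 2) := by
  have hN' : (N : ℂ) ≠ 0 := by exact_mod_cast hN.ne'
  rw [show N * (z + 2 * π / N) / 2 = N * z / 2 + π by field_simp]
  exact Complex.tan_periodic _

theorem integral_tan_mul_horizontal_symm {N : ℕ} (hN : 0 < N) (hNeven : Even N) {γ : ℝ}
    (hγ : 0 < γ) {f : ℂ → ℂ} (hf : AnalyticOnNhd ℂ f {z | |z.im| ≤ γ})
    (hper : ∀ z : ℂ, |z.im| ≤ γ → f (z + 2 * π) = f z)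
    (hzero : ∀ x : ℝ, Complex.cos (N * x / 2) = 0 → f x = 0) :
    ∫ x in (-π)..π, Complex.tan (N * (x + γ * I) / 2) * f (x + γ * I) =
      ∫ x in (-π)..π, Complex.tan (N * (x + (-γ : ℝ) * I) / 2) * f (x + (-γ : ℝ) * I) := by
  set a : ℂ → ℂ := fun z => Complex.sin (N * z / 2) * f z with ha
  set b : ℂ → ℂ := fun z => Complex.cos (N * z / 2) with hb
  have hq : ∀ z, b z ≠ 0 → lhopitalDiv a b z = Complex.tan (N * z / 2) * f z := fun z hz => by
    rw [lhopitalDiv, if_neg hz, Complex.tan, ha, hb]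
    ring
  have hline : ∀ y : ℝ, y ≠ 0 → ∀ x : ℝ, lhopitalDiv a b (x + y * I) =
      Complex.tan (N * (x + y * I) / 2) * f (x + y * I) := fun y hy x =>
    hq _ (cos_nat_mul_half_ne_zero hN (by simpa using hy))
  have hdiff : ∀ z : ℂ, |z.im| ≤ γ → DifferentiableAt ℂ (lhopitalDiv a b) z := by
    intro z hz
    refine differentiableAt_lhopitalDiv ?_ ?_ fun hbz => ⟨?_, ?_⟩
    · exact AnalyticAt.mul (by fun_prop) (hf z hz)
    · fun_prop
    · have him : z.im = 0 := by
        by_contra h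
        exact cos_nat_mul_half_ne_zero hN h hbz
      obtain ⟨x, rfl⟩ : ∃ x : ℝ, (x : ℂ) = z := ⟨z.re, Complex.ext (by simp) (by simp [him])⟩
      simp [ha, hzero x hbz]
    · have hd : HasDerivAt b (-Complex.sin (N * z / 2) * (N * 1 / 2)) z :=
        (((hasDerivAt_id z).const_mul (N : ℂ)).div_const 2).ccos
      rw [hd.deriv]
      have hs : Complex.sin (N * z / 2) ≠ 0 := fun hs => by
        have := Complex.sin_sq_add_cos_sq (N * z / 2)
        rw [hs, show Complex.cos (N * z / 2) = 0 from hbz] at this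
        simp at this
      simpa using ⟨hs, hN.ne'⟩
  have hvert : ∀ y : ℝ, |y| ≤ γ →
      lhopitalDiv a b (π + y * I) = lhopitalDiv a b ((-π : ℝ) + y * I) := by
    intro y hy
    have e : (π + y * I : ℂ) = ((-π : ℝ) + y * I) + 2 * π := by push_cast; ring
    have hc := cos_nat_mul_half_ne_zero_of_even hNeven y
    obtain ⟨m, hm⟩ := hNeven
    have e' : (N * (π + y * I) / 2 : ℂ) = N * ((-π : ℝ) + y * I) / 2 + (2 * m : ℕ) * π := by
      rw [hm]; push_cast; ring
    have hc' : Complex.cos (N * ((-π : ℝ) + y * I) / 2) ≠ 0 := fun h0 => hc <| by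
      rw [e', show (((2 * m : ℕ) : ℂ) * π) = m * (2 * π) by push_cast; ring,
        Complex.cos_add_nat_mul_two_pi, h0]
    rw [hq _ hc, hq _ hc', e', Complex.tan_add_nat_mul_pi, e, hper _ (by simpa using hy)]
  have := integral_horizontal_eq_of_periodic hdiff hvert (y₁ := γ) (y₂ := -γ)
    (abs_of_pos hγ).le (by rw [abs_neg, abs_of_pos hγ])
  simpa only [hline γ hγ.ne', hline (-γ) (neg_ne_zero.2 hγ.ne')] using this

theorem integral_one_add_I_mul_tan {N : ℕ} (hN : 0 < N) {γ : ℝ} (hγ : 0 < γ) :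
    ∫ x in (-π)..π, (1 + I * Complex.tan (N * (x + γ * I) / 2)) = 0 := by
  have hN' : (N : ℂ) ≠ 0 := by exact_mod_cast hN.ne'
  have hd : ∀ x : ℝ, HasDerivAt
      (fun x : ℝ => 2 / (I * N) * Complex.log (1 + Complex.exp (I * (N * (x + γ * I)))))
      (1 + I * Complex.tan (N * (x + γ * I) / 2)) x := by
    intro x
    have hnorm : ‖Complex.exp (I * (N * (x + γ * I)))‖ < 1 := by
      rw [Complex.norm_exp, Real.exp_lt_one_iff]
      have : 0 < (N : ℝ) * γ := by positivity
      simpa [mul_re, mul_im] using this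
    have hslit := mem_slitPlane_of_norm_lt_one hnorm
    have h1 : HasDerivAt (fun x : ℝ => I * (N * (x + γ * I)) : ℝ → ℂ) (I * (N * 1)) x :=
      ((((hasDerivAt_id x).ofReal_comp).add_const (γ * I)).const_mul (N : ℂ)).const_mul I
    have h2 := ((h1.cexp.const_add 1).clog_real hslit).const_mul (2 / (I * N))
    refine h2.congr_deriv ?_
    have hne := slitPlane_ne_zero hslit
    have hc : Complex.cos (N * (x + γ * I) / 2) ≠ 0 :=
      cos_nat_mul_half_ne_zero hN (by simpa using hγ.ne')
    set w : ℂ := N * (x + γ * I) / 2 with hw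
    have hE : Complex.exp (I * (N * (x + γ * I))) = Complex.exp (w * I) * Complex.exp (w * I) := by
      rw [← Complex.exp_add]; congr 1; rw [hw]; ring
    have hinv : Complex.exp (w * I) * Complex.exp (-w * I) = 1 := by
      rw [← Complex.exp_add]; simp
    rw [hE] at hne ⊢
    have h3 : (1 + I * Complex.tan w) * Complex.cos w = Complex.exp (w * I) := by
      rw [add_mul, one_mul, mul_assoc, Complex.tan_mul_cos hc, Complex.exp_mul_I]; ring
    have h4 : 1 + Complex.exp (w * I) * Complex.exp (w * I) =
        2 * Complex.cos w * Complex.exp (w * I) := by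
      rw [Complex.cos]; linear_combination -hinv
    rw [h4]
    have hI := I_ne_zero
    have hexp := Complex.exp_ne_zero (w * I)
    rw [← mul_left_inj' hc, h3]
    field_simp
  rw [intervalIntegral.integral_eq_sub_of_hasDerivAt (fun x _ => hd x)
    ((continuous_const.add (continuous_const.mul
      (continuous_tan_horizontal hN hγ.ne'))).intervalIntegrable _ _)]
  have e : Complex.exp (I * (N * ((π : ℝ) + γ * I))) =
      Complex.exp (I * (N * ((-π : ℝ) + γ * I))) := by
    rw [← Complex.exp_periodic.nat_mul N (I * (N * ((-π : ℝ) + γ * I)))]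
    congr 1; push_cast; ring
  rw [e, sub_self]

theorem integral_one_sub_I_mul_tan {N : ℕ} (hN : 0 < N) {γ : ℝ} (hγ : 0 < γ) :
    ∫ x in (-π)..π, (1 - I * Complex.tan (N * (x + (-γ : ℝ) * I) / 2)) = 0 := by
  rw [← integral_one_add_I_mul_tan hN hγ]
  conv_rhs => rw [← neg_neg π, ← intervalIntegral.integral_comp_neg, neg_neg]
  refine intervalIntegral.integral_congr fun x _ => ?_
  rw [show (N * (((-x : ℝ) : ℂ) + γ * I) / 2) = -(N * (x + (-γ : ℝ) * I) / 2) by push_cast; ring,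
    Complex.tan_neg]
  ring

theorem integral_tan_kernel_of_zero {N : ℕ} (hN : 0 < N) (hNeven : Even N) {γ : ℝ}
    (hγ : 0 < γ) {f : ℂ → ℂ} (hf : AnalyticOnNhd ℂ f {z | |z.im| ≤ γ})
    (hper : ∀ z : ℂ, |z.im| ≤ γ → f (z + 2 * π) = f z)
    (hzero : ∀ x : ℝ, Complex.cos (N * x / 2) = 0 → f x = 0) :
    (∫ x in (-π)..π, (1 + I * Complex.tan (N * (x + γ * I) / 2)) * f (x + γ * I)) +
      (∫ x in (-π)..π, (1 - I * Complex.tan (N * (x + (-γ : ℝ) * I) / 2)) * f (x + (-γ : ℝ) * I)) =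
      2 * ∫ x in (-π)..π, f x := by
  have hp : |γ| ≤ γ := (abs_of_pos hγ).le
  have hm : |-γ| ≤ γ := by rwa [abs_neg]
  have hc₁ := continuous_comp_horizontal hp hf
  have hc₂ := continuous_comp_horizontal hm hf
  have ht₁ : Continuous fun x : ℝ =>
      I * (Complex.tan (N * (x + γ * I) / 2) * f (x + γ * I)) :=
    continuous_const.mul ((continuous_tan_horizontal hN hγ.ne').mul hc₁)
  have ht₂ : Continuous fun x : ℝ =>
      I * (Complex.tan (N * (x + (-γ : ℝ) * I) / 2) * f (x + (-γ : ℝ) * I)) :=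
    continuous_const.mul ((continuous_tan_horizontal hN (neg_ne_zero.2 hγ.ne')).mul hc₂)
  have hvert : ∀ y : ℝ, |y| ≤ γ → f (π + y * I) = f ((-π : ℝ) + y * I) := fun y hy => by
    rw [← hper ((-π : ℝ) + y * I) (by simpa using hy)]
    congr 1; push_cast; ring
  have hd : ∀ z : ℂ, |z.im| ≤ γ → DifferentiableAt ℂ f z := fun z hz => (hf z hz).differentiableAt
  have e₁ := integral_horizontal_eq_of_periodic hd hvert (y₂ := 0) hp (by simpa using hγ.le)
  have e₂ := integral_horizontal_eq_of_periodic hd hvert (y₂ := 0) hm (by simpa using hγ.le)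
  simp only [ofReal_zero, zero_mul, add_zero] at e₁ e₂
  have e₃ := integral_tan_mul_horizontal_symm hN hNeven hγ hf hper hzero
  have split₁ : ∀ x : ℝ, (1 + I * Complex.tan (N * (x + γ * I) / 2)) * f (x + γ * I) =
      f (x + γ * I) + I * (Complex.tan (N * (x + γ * I) / 2) * f (x + γ * I)) := fun x => by ring
  have split₂ : ∀ x : ℝ,
      (1 - I * Complex.tan (N * (x + (-γ : ℝ) * I) / 2)) * f (x + (-γ : ℝ) * I) =
        f (x + (-γ : ℝ) * I) -
          I * (Complex.tan (N * (x + (-γ : ℝ) * I) / 2) * f (x + (-γ : ℝ) * I)) :=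
    fun x => by ring
  simp only [split₁, split₂]
  rw [intervalIntegral.integral_add (hc₁.intervalIntegrable _ _)
      (ht₁.intervalIntegrable _ _),
    intervalIntegral.integral_sub (hc₂.intervalIntegrable _ _)
      (ht₂.intervalIntegrable _ _),
    intervalIntegral.integral_const_mul, intervalIntegral.integral_const_mul, e₁, e₂, e₃]
  ring

theorem periodic_sum_range_shift {φ : ℝ → ℂ} {N : ℕ} {h : ℝ} (hφ : Function.Periodic φ (N * h)) :
    Function.Periodic (fun x => ∑ j ∈ Finset.range N, φ (x + j * h)) h := by
  intro x
  have h₁ := Finset.sum_range_succ (fun j : ℕ => φ (x + j * h)) N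
  rw [Finset.sum_range_succ', hφ x, Nat.cast_zero, zero_mul, add_zero, add_left_inj] at h₁
  beta_reduce
  rw [← h₁]
  refine Finset.sum_congr rfl fun j _ => ?_
  congr 1; push_cast; ring

theorem integral_periodic_mul_sum_range_shift {K φ : ℝ → ℂ} {N : ℕ} {h : ℝ}
    (hK : Function.Periodic K h) (hφ : Function.Periodic φ (N * h)) (hKc : Continuous K)
    (hφc : Continuous φ) (a : ℝ) (C : ℂ) :
    ∫ x in a..(a + N * h), K x * (∑ j ∈ Finset.range N, φ (x + j * h) - C) =
      N * (∫ x in a..(a + N * h), K x * φ x) - (∫ x in a..(a + N * h), K x) * C := by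
  have hshift : ∀ j ∈ Finset.range N, ∫ x in a..(a + N * h), K x * φ (x + j * h) =
      ∫ x in a..(a + N * h), K x * φ x := by
    intro j _
    have hper : Function.Periodic (fun x => K x * φ x) (N * h) := fun x => by
      simp only [hφ x, hK.nat_mul N x]
    have e : ∀ x, K x * φ (x + j * h) = (fun x => K x * φ x) (x + j * h) := fun x => by
      simp only [hK.nat_mul j x]
    simp only [e]
    rw [intervalIntegral.integral_comp_add_right (fun x => K x * φ x),
      show a + N * h + j * h = (a + j * h) + N * h by ring]
    exact hper.intervalIntegral_add_eq _ _
  simp only [mul_sub, Finset.mul_sum]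
  rw [intervalIntegral.integral_sub
      (Continuous.intervalIntegrable (by fun_prop) _ _)
      (Continuous.intervalIntegrable (by fun_prop) _ _),
    intervalIntegral.integral_finsetSum
      fun j _ => Continuous.intervalIntegrable (by fun_prop) _ _,
    Finset.sum_congr rfl hshift, intervalIntegral.integral_mul_const]
  simp

theorem sum_midpoints_eq_of_cos_eq_zero {φ : ℝ → ℂ} {N : ℕ} (hN : 0 < N) (hNeven : Even N)
    (hφ : Function.Periodic φ (2 * π)) {x : ℝ} (hx : Complex.cos (N * x / 2) = 0) :
    ∑ j ∈ Finset.range N, φ (x + j * (2 * π / N)) =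
      ∑ k ∈ Finset.Icc 1 N, φ (-π + ((k : ℝ) - 1 / 2) * (2 * π / N)) := by
  have hN' : (N : ℝ) ≠ 0 := by positivity
  have hper := periodic_sum_range_shift (φ := φ) (N := N) (h := 2 * π / N)
    (by rwa [mul_div_cancel₀ _ hN'])
  obtain ⟨k, hk⟩ := Complex.cos_eq_zero_iff.1 hx
  obtain ⟨m, hm⟩ := hNeven
  have hk' : (N : ℝ) * x / 2 = (2 * k + 1) * π / 2 := by exact_mod_cast hk
  have hxk : x = (-π + 1 / 2 * (2 * π / N)) + ((k + m : ℤ) : ℝ) * (2 * π / N) := by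
    have hm' : (N : ℝ) = m + m := by exact_mod_cast hm
    field_simp
    push_cast
    rw [show (m : ℝ) = N / 2 by linarith]
    linarith
  have h₁ := hper.int_mul (k + m) (-π + 1 / 2 * (2 * π / N))
  rw [← hxk] at h₁
  rw [h₁, show Finset.Icc 1 N = Finset.Ico (0 + 1) (N + 1) by rfl,
    ← Finset.sum_Ico_add' (fun k : ℕ => φ (-π + ((k : ℝ) - 1 / 2) * (2 * π / N))),
    Finset.range_eq_Ico]
  refine Finset.sum_congr rfl fun j _ => ?_
  congr 1; push_cast; ring

theorem integral_tan_kernel_eq {N : ℕ} (hN : 0 < N) (hNeven : Even N) {γ : ℝ}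
    (hγ : 0 < γ) {g : ℂ → ℂ} (hg : AnalyticOnNhd ℂ g {z | |z.im| ≤ γ})
    (hper : ∀ z : ℂ, |z.im| ≤ γ → g (z + 2 * π) = g z) :
    (∫ x in (-π)..π, (1 + I * Complex.tan (N * (x + γ * I) / 2)) * g (x + γ * I)) +
      (∫ x in (-π)..π, (1 - I * Complex.tan (N * (x + (-γ : ℝ) * I) / 2)) * g (x + (-γ : ℝ) * I)) =
      2 * ((∫ x in (-π)..π, g x) - (2 * π / N) *
        ∑ k ∈ Finset.Icc 1 N, g ((-π + ((k : ℝ) - 1 / 2) * (2 * π / N) : ℝ) : ℂ)) := by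
  have hN' : (N : ℝ) ≠ 0 := by positivity
  have hNc : (N : ℂ) ≠ 0 := by exact_mod_cast hN.ne'
  set C := ∑ k ∈ Finset.Icc 1 N, g ((-π + ((k : ℝ) - 1 / 2) * (2 * π / N) : ℝ) : ℂ) with hC
  set h : ℝ := 2 * π / N with hh
  have hNh : (N : ℝ) * h = 2 * π := mul_div_cancel₀ _ hN'
  have hend : -π + N * h = π := by rw [hNh]; ring
  have him : ∀ (z : ℂ) (j : ℕ), (z + j * h).im = z.im := fun z j => by simp
  have hline : ∀ y : ℝ, |y| ≤ γ → Function.Periodic (fun x : ℝ => g (x + y * I)) (N * h) := by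
    intro y hy x
    beta_reduce
    rw [← hper (x + y * I) (by simpa using hy), hNh]
    congr 1; push_cast; ring
  have htan : ∀ y : ℝ, Function.Periodic (fun x : ℝ => Complex.tan (N * (x + y * I) / 2)) h := by
    intro y x
    beta_reduce
    rw [← tan_nat_mul_half_add N hN (x + y * I)]
    congr 2; rw [hh]; push_cast; ring
  have hp : |γ| ≤ γ := (abs_of_pos hγ).le
  have hm : |-γ| ≤ γ := by rwa [abs_neg]
  have h0 : |(0 : ℝ)| ≤ γ := by simpa using hγ.le
  have key := integral_tan_kernel_of_zero hN hNeven hγ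
    (f := fun z => ∑ j ∈ Finset.range N, g (z + j * h) - C) ?_ ?_ ?_
  · have hshift : ∀ (x y : ℝ) (j : ℕ),
        g (x + y * I + j * h) = (fun x : ℝ => g (x + y * I)) (x + j * h) := fun x y j => by
      beta_reduce; congr 1; push_cast; ring
    have hshift₀ : ∀ (x : ℝ) (j : ℕ),
        g (x + j * h) = (fun x : ℝ => g x) (x + j * h) := fun x j => by
      beta_reduce; congr 1; push_cast; ring
    have e₁ := integral_periodic_mul_sum_range_shift
      (K := fun x : ℝ => 1 + I * Complex.tan (N * (x + γ * I) / 2))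
      (fun x => by simp only [htan γ x]) (hline γ hp)
      (continuous_const.add (continuous_const.mul (continuous_tan_horizontal hN hγ.ne')))
      (continuous_comp_horizontal hp hg) (-π) C
    have e₂ := integral_periodic_mul_sum_range_shift
      (K := fun x : ℝ => 1 - I * Complex.tan (N * (x + (-γ : ℝ) * I) / 2))
      (fun x => by simp only [htan (-γ) x]) (hline (-γ) hm)
      (continuous_const.sub (continuous_const.mul
        (continuous_tan_horizontal hN (neg_ne_zero.2 hγ.ne'))))
      (continuous_comp_horizontal hm hg) (-π) C
    have e₃ := integral_periodic_mul_sum_range_shift (K := fun _ : ℝ => 1) (fun x => rfl)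
      (φ := fun x : ℝ => g x) (by simpa using hline 0 h0) continuous_const
      (by simpa using continuous_comp_horizontal h0 hg) (-π) C
    rw [hend] at e₁ e₂ e₃
    simp only [integral_one_add_I_mul_tan hN hγ] at e₁
    simp only [integral_one_sub_I_mul_tan hN hγ] at e₂
    simp only [one_mul, intervalIntegral.integral_const] at e₃
    simp only [hshift, hshift₀] at key
    rw [e₁, e₂, e₃] at key
    rw [← mul_right_inj' hNc]
    have hs : ((π - -π) • (1 : ℂ)) = 2 * π := by rw [real_smul]; push_cast; ring
    rw [hs] at key
    have hd : (N : ℂ) * (2 * π / N) = 2 * π := mul_div_cancel₀ _ hNc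
    linear_combination key + 2 * C * hd
  · intro z hz
    refine AnalyticAt.sub ?_ analyticAt_const
    refine Finset.analyticAt_fun_sum _ fun j _ => ?_
    have hmem : z + j * h ∈ {z : ℂ | |z.im| ≤ γ} := by
      rw [mem_ofPred_eq, him]; exact hz
    exact AnalyticAt.comp (f := fun z : ℂ => z + j * h) (hg _ hmem) (by fun_prop)
  · intro z hz
    congr 1
    refine Finset.sum_congr rfl fun j _ => ?_
    rw [← hper (z + j * h) (by rwa [him])]
    congr 1; ring
  · intro x hx
    have hφ : Function.Periodic (fun x : ℝ => g x) (2 * π) := by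
      simpa [hNh] using hline 0 h0
    have := sum_midpoints_eq_of_cos_eq_zero hN hNeven hφ hx
    rw [sub_eq_zero, hC, ← this]
    refine Finset.sum_congr rfl fun j _ => ?_
    rw [← hh]
    congr 1; push_cast; ring

open ComplexConjugate in
/-- The Schwarz reflection identity on a closed strip. -/
theorem apply_conj_of_real_on_real {γ : ℝ} (hγ : 0 ≤ γ) {g : ℂ → ℂ}
    (hg : AnalyticOnNhd ℂ g {z | |z.im| ≤ γ}) (hreal : ∀ x : ℝ, (g x).im = 0)
    {z : ℂ} (hz : |z.im| ≤ γ) : g (conj z) = conj (g z) := by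
  have hconj : AnalyticOnNhd ℂ (conj ∘ g ∘ conj) {z | |z.im| ≤ γ} := by
    intro w hw
    rw [Complex.analyticAt_iff_eventually_differentiableAt]
    have hw' : conj w ∈ {z : ℂ | |z.im| ≤ γ} := by simpa using hw
    have hev := (hg _ hw').eventually_analyticAt
    filter_upwards [Complex.continuous_conj.continuousAt.eventually hev] with u hu
    simpa using hu.differentiableAt.conj_conj
  have hpre : IsPreconnected {z : ℂ | |z.im| ≤ γ} := by
    have : {z : ℂ | |z.im| ≤ γ} = Complex.imLm ⁻¹' Icc (-γ) γ := by
      ext z; simp [abs_le]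
    rw [this]
    exact ((convex_Icc _ _).linear_preimage _).isPreconnected
  have hfreq : ∃ᶠ w in 𝓝[≠] (0 : ℂ), (conj ∘ g ∘ conj) w = g w := by
    have htend : Tendsto (fun x : ℝ => (x : ℂ)) (𝓝[≠] 0) (𝓝[≠] 0) := by
      refine tendsto_nhdsWithin_iff.2 ⟨?_, ?_⟩
      · exact (Complex.continuous_ofReal.tendsto' 0 0 (by simp)).mono_left nhdsWithin_le_nhds
      · filter_upwards [self_mem_nhdsWithin] with x hx
        simpa using hx
    refine htend.frequently (Eventually.frequently (Eventually.of_forall fun x => ?_))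
    simp [Complex.conj_eq_iff_im.2 (hreal x)]
  have h := hconj.eqOn_of_preconnected_of_frequently_eq hg hpre (by simpa using hγ) hfreq hz
  rw [← h]
  simp

theorem segIntegral_horizontal_s2 (f : ℂ → ℂ) (γ : ℝ) :
    segIntegral f (-(π : ℂ) + I * γ) ((π : ℂ) + I * γ) = ∫ x in (-π)..π, f (x + γ * I) := by
  have h := intervalIntegral.smul_integral_comp_add_mul (a := 0) (b := 1)
    (fun x : ℝ => f (x + γ * I)) (2 * π) (-π)
  rw [show -π + 2 * π * 0 = -π by ring, show -π + 2 * π * 1 = π by ring] at h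
  rw [← h, segIntegral, real_smul]
  congr 1
  · push_cast; ring
  · refine intervalIntegral.integral_congr fun s _ => ?_
    congr 1; push_cast; ring

/-- **Midpoint rule error for periodic real-valued analytic functions.**
If `g` is analytic on an open set containing the closed strip `|Im θ| ≤ γ`,
`2π`-periodic on the strip and real-valued on the real axis, then for even `N`
the midpoint rule error equals the real part of a single segment integral
along `Im θ = γ`. -/
theorem midpoint_error_formula_periodic
    (γ₀ : ℝ) (hγ₀ : 0 < γ₀) (γ : ℝ) (hγ0 : 0 < γ) (hγ : γ < γ₀)
    (g : ℂ → ℂ) (U : Set ℂ) (hU : IsOpen U)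
    (hstrip : {θ : ℂ | |θ.im| ≤ γ} ⊆ U)
    (hg : ∀ z ∈ U, AnalyticAt ℂ g z)
    (hper : ∀ θ : ℂ, |θ.im| ≤ γ → g (θ + 2 * π) = g θ)
    (hreal : ∀ x : ℝ, (g (x : ℂ)).im = 0)
    (N : ℕ) (hN : 0 < N) (hNeven : Even N) :
    (∫ x in (-π : ℝ)..π, g (x : ℂ)) -
      (2 * π / N) * ∑ k ∈ Finset.Icc 1 N, g ((-π + ((k : ℝ) - 1/2) * (2 * π / N) : ℝ) : ℂ) =
    ((segIntegral (fun θ => (1 + I * Complex.tan (N * θ / 2)) * g θ)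
        (-(π:ℂ) + I * γ) ((π:ℂ) + I * γ)).re : ℂ) := by
  have hγ' : |γ| ≤ γ := (abs_of_pos hγ0).le
  have hg' : AnalyticOnNhd ℂ g {z | |z.im| ≤ γ} := fun z hz => hg z (hstrip hz)
  have hbot : ∫ x in (-π)..π,
        (1 - I * Complex.tan (N * (x + (-γ : ℝ) * I) / 2)) * g (x + (-γ : ℝ) * I) =
      (starRingEnd ℂ)
        (∫ x in (-π)..π, (1 + I * Complex.tan (N * (x + γ * I) / 2)) * g (x + γ * I)) := by
    rw [← intervalIntegral.intervalIntegral_conj]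
    refine intervalIntegral.integral_congr fun x _ => ?_
    have e : (x + (-γ : ℝ) * I : ℂ) = (starRingEnd ℂ) (x + γ * I) := by simp
    have ht : Complex.tan (N * (starRingEnd ℂ) (x + γ * I) / 2) =
        (starRingEnd ℂ) (Complex.tan (N * (x + γ * I) / 2)) := by
      rw [← Complex.tan_conj, map_div₀, map_mul, map_natCast, map_ofNat]
    rw [e, apply_conj_of_real_on_real hγ0.le hg' hreal (by simpa using hγ'), ht, map_mul, map_add,
      map_one, map_mul, conj_I]
    ring
  have key := integral_tan_kernel_eq hN hNeven hγ0 hg' hper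
  rw [hbot, Complex.add_conj] at key
  rw [segIntegral_horizontal_s2]
  push_cast at key
  push_cast
  linear_combination -key / 2
end

section
/- Let 0 < α < 1 and c > 0 be real numbers such that D := 2αc² sin²(απ) - π sin(2απ) sinh²(αc) ≠ 0, and define B = c sin²(απ)/D, σ = 2αc²B, μ = 2 sinh²(αc) B, ν = (sinh(2αc) - 2αc) B. Let ζ(θ) = -σ + μ θ cot(αθ) + i ν θ (complex cotangent, with ζ(0) = -σ + μ/α). Then ζ(ic) = 0, ζ′(ic) = 0, and Re ζ(π) = -c; moreover (σ, μ, ν) is the unique triple of real numbers with these three properties. -/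
open Complex Real

/-- The modified Talbot contour shape function `ζ(θ) = -σ + μθcot(αθ) + iνθ`
(complex cotangent). -/
noncomputable def talbotZeta (α σ μ ν : ℝ) (θ : ℂ) : ℂ :=
  -(σ : ℂ) + (μ : ℂ) * θ * Complex.cot ((α : ℂ) * θ) + Complex.I * (ν : ℂ) * θ

/-- The complex derivative of the modified Talbot contour shape function:
`ζ'(θ) = μcot(αθ) - μαθ/sin²(αθ) + iν`. -/
noncomputable def talbotZetaDeriv (α σ μ ν : ℝ) (θ : ℂ) : ℂ :=
  (μ : ℂ) * Complex.cot ((α : ℂ) * θ) -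
    (μ : ℂ) * (α : ℂ) * θ / (Complex.sin ((α : ℂ) * θ)) ^ 2 + Complex.I * (ν : ℂ)

/-- The three defining conditions of the modified Talbot parameters:
a double root of `ζ` at `ic` and `Re ζ(π) = -c`. -/
noncomputable def talbotConditions (α c σ μ ν : ℝ) : Prop :=
  talbotZeta α σ μ ν (Complex.I * c) = 0 ∧
  talbotZetaDeriv α σ μ ν (Complex.I * c) = 0 ∧
  (talbotZeta α σ μ ν (π : ℂ)).re = -c

theorem Complex.cot_I_mul_ofReal (x : ℝ) :
    Complex.cot (I * x) = -(I * ((Real.cosh x / Real.sinh x : ℝ) : ℂ)) := by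
  rw [Complex.cot, mul_comm I, Complex.cos_mul_I, Complex.sin_mul_I]
  push_cast
  rw [mul_comm, ← div_div, Complex.div_I]
  ring

theorem Complex.sin_I_mul_ofReal_sq (x : ℝ) :
    Complex.sin (I * x) ^ 2 = ((-Real.sinh x ^ 2 : ℝ) : ℂ) := by
  rw [mul_comm I, Complex.sin_mul_I, mul_pow, I_sq]
  push_cast
  ring

theorem talbotZeta_I_mul (α c σ μ ν : ℝ) :
    talbotZeta α σ μ ν (I * c) =
      ((-σ + μ * c * (Real.cosh (α * c) / Real.sinh (α * c)) - ν * c : ℝ) : ℂ) := by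
  have h : (α : ℂ) * (I * c) = I * ((α * c : ℝ) : ℂ) := by push_cast; ring
  rw [talbotZeta, h, Complex.cot_I_mul_ofReal]
  generalize Real.cosh (α * c) / Real.sinh (α * c) = q
  push_cast
  linear_combination (-(μ : ℂ) * c * q + ν * c) * I_sq

theorem talbotZetaDeriv_I_mul (α c σ μ ν : ℝ) :
    talbotZetaDeriv α σ μ ν (I * c) =
      I * ((-(μ * (Real.cosh (α * c) / Real.sinh (α * c)))
        + μ * (α * c) / Real.sinh (α * c) ^ 2 + ν : ℝ) : ℂ) := by
  have h : (α : ℂ) * (I * c) = I * ((α * c : ℝ) : ℂ) := by push_cast; ring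
  rw [talbotZetaDeriv, h, Complex.cot_I_mul_ofReal, Complex.sin_I_mul_ofReal_sq]
  push_cast
  rw [div_neg]
  ring

theorem talbotZeta_ofReal_re (α σ μ ν θ : ℝ) :
    (talbotZeta α σ μ ν (θ : ℂ)).re =
      -σ + μ * θ * (Real.cos (α * θ) / Real.sin (α * θ)) := by
  have h : talbotZeta α σ μ ν (θ : ℂ) =
      ((-σ + μ * θ * (Real.cos (α * θ) / Real.sin (α * θ)) : ℝ) : ℂ)
        + ((ν * θ : ℝ) : ℂ) * I := by
    rw [talbotZeta, Complex.cot]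
    push_cast
    ring
  rw [h]
  simp only [add_re, ofReal_re, re_ofReal_mul, I_re, mul_zero, add_zero]

/-- The three conditions amount to a real linear system in `σ`, `μ`, `ν`. -/
theorem talbotConditions_iff {α c : ℝ} (hsinh : Real.sinh (α * c) ≠ 0)
    (hsin : Real.sin (α * π) ≠ 0) (σ μ ν : ℝ) :
    talbotConditions α c σ μ ν ↔
      μ * c * Real.cosh (α * c) = (σ + ν * c) * Real.sinh (α * c) ∧
      ν * Real.sinh (α * c) ^ 2 =
        μ * (Real.cosh (α * c) * Real.sinh (α * c) - α * c) ∧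
      μ * π * Real.cos (α * π) = (σ - c) * Real.sin (α * π) := by
  rw [talbotConditions, talbotZeta_I_mul, talbotZetaDeriv_I_mul, talbotZeta_ofReal_re,
    ofReal_eq_zero, mul_eq_zero_iff_left I_ne_zero, ofReal_eq_zero]
  generalize Real.sinh (α * c) = S, Real.cosh (α * c) = C, Real.sin (α * π) = s,
    Real.cos (α * π) = k at *
  refine and_congr ?_ (and_congr ?_ ?_)
  · field_simp
    constructor <;> intro h <;> linear_combination h
  · field_simp
    constructor <;> intro h <;> linear_combination h
  · field_simp
    constructor <;> intro h <;> linear_combination h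

/-- **Determination of the modified Talbot parameters.** For `0 < α < 1`, `c > 0`
with `D = 2αc²sin²(απ) - πsin(2απ)sinh²(αc) ≠ 0`, the parameters
`σ = 2αc²B`, `μ = 2sinh²(αc)B`, `ν = (sinh(2αc) - 2αc)B`, `B = c·sin²(απ)/D`
satisfy `ζ(ic) = 0`, `ζ'(ic) = 0`, `Re ζ(π) = -c`, and are the unique real triple
with these properties. -/
theorem talbot_parameters_unique
    (α c : ℝ) (hα0 : 0 < α) (hα1 : α < 1) (hc : 0 < c)
    (hD : 2 * α * c ^ 2 * Real.sin (α * π) ^ 2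
            - π * Real.sin (2 * α * π) * Real.sinh (α * c) ^ 2 ≠ 0)
    (B σ μ ν : ℝ)
    (hB : B = c * Real.sin (α * π) ^ 2 /
      (2 * α * c ^ 2 * Real.sin (α * π) ^ 2
        - π * Real.sin (2 * α * π) * Real.sinh (α * c) ^ 2))
    (hσ : σ = 2 * α * c ^ 2 * B)
    (hμ : μ = 2 * Real.sinh (α * c) ^ 2 * B)
    (hν : ν = (Real.sinh (2 * α * c) - 2 * α * c) * B) :
    talbotConditions α c σ μ ν ∧
      ∀ σ' μ' ν' : ℝ, talbotConditions α c σ' μ' ν' →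
        σ' = σ ∧ μ' = μ ∧ ν' = ν := by
  have hsinh : Real.sinh (α * c) ≠ 0 := (Real.sinh_pos_iff.2 (mul_pos hα0 hc)).ne'
  have hsin : Real.sin (α * π) ≠ 0 :=
    (Real.sin_pos_of_pos_of_lt_pi (mul_pos hα0 pi_pos) (by nlinarith [pi_pos])).ne'
  have hsin2 : Real.sin (2 * α * π) = 2 * Real.sin (α * π) * Real.cos (α * π) := by
    rw [mul_assoc, Real.sin_two_mul]
  have hsinh2 : Real.sinh (2 * α * c) = 2 * Real.sinh (α * c) * Real.cosh (α * c) := by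
    rw [mul_assoc, Real.sinh_two_mul]
  rw [eq_div_iff hD, hsin2] at hB
  rw [hsin2] at hD
  rw [hsinh2] at hν
  have hBlin : B * (2 * α * c ^ 2 * Real.sin (α * π)
      - 2 * π * Real.cos (α * π) * Real.sinh (α * c) ^ 2) = c * Real.sin (α * π) :=
    mul_right_cancel₀ hsin (by linear_combination hB)
  refine ⟨(talbotConditions_iff hsinh hsin σ μ ν).2 ⟨?_, ?_, ?_⟩, fun σ' μ' ν' h => ?_⟩
  · subst hσ hμ hν
    ring
  · subst hμ hν
    ring
  · subst hσ hμ
    linear_combination -hBlin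
  obtain ⟨h₁, h₂, h₃⟩ := (talbotConditions_iff hsinh hsin σ' μ' ν').1 h
  have hσ' : σ' * Real.sinh (α * c) ^ 2 = μ' * α * c ^ 2 := by
    linear_combination -Real.sinh (α * c) * h₁ - c * h₂
  have hμ' : μ' = μ := by
    refine mul_right_cancel₀ hD ?_
    rw [hμ]
    linear_combination -2 * Real.sin (α * π) ^ 2 * hσ'
      - 2 * Real.sin (α * π) * Real.sinh (α * c) ^ 2 * h₃
      - 2 * Real.sinh (α * c) ^ 2 * hB
  have hsq := pow_ne_zero 2 hsinh
  refine ⟨mul_right_cancel₀ hsq ?_, hμ', mul_right_cancel₀ hsq ?_⟩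
  · rw [hσ', hμ', hμ, hσ]
    ring
  · rw [h₂, hμ', hμ, hν]
    ring
end

section
/- Let t > 0, μ > 0, ν > 0, σ ∈ ℝ, and let λ ∈ ℝ with λ > σ - μ. Define the Talbot contour z(θ) = -σ + μ θ cot(θ) + i ν θ for θ ∈ (-π, π) (with z(0) = -σ + μ), so that Re z(θ) → -∞ as θ → ±π. Define g(θ) = e^{t z(θ)} z′(θ)/(z(θ) + λ) for θ ∈ (-π, π) and g(±π) = 0. Then g is integrable on [-π, π] and (1/(2πi)) ∫_{-π}^{π} g(θ) dθ = e^{-λ t}; that is, the deformed Bromwich integral over the Talbot contour recovers the inverse Laplace transform of F(z) = 1/(z + λ). -/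
open Complex Real MeasureTheory

/-- The classical Talbot contour `z(θ) = -σ + μθcot(θ) + iνθ`, with the
removable singularity at `θ = 0` filled in by `z(0) = -σ + μ`. -/
noncomputable def classicTalbotZ (σ μ ν : ℝ) (θ : ℝ) : ℂ :=
  if θ = 0 then (-(σ : ℂ) + (μ : ℂ))
  else -(σ : ℂ) + (μ : ℂ) * (θ : ℂ) * Complex.cot (θ : ℂ) + Complex.I * (ν : ℂ) * (θ : ℂ)

/-- The integrand `g(θ) = e^{t z(θ)} z'(θ)/(z(θ) + λ)` of the deformed Bromwich
integral for the transform `F(z) = 1/(z+λ)`, with `g(±π) = 0`. -/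
noncomputable def talbotBromwichIntegrand (σ μ ν lam t : ℝ) (θ : ℝ) : ℂ :=
  if θ = π ∨ θ = -π then 0
  else Complex.exp ((t : ℂ) * classicTalbotZ σ μ ν θ) *
        deriv (classicTalbotZ σ μ ν) θ / (classicTalbotZ σ μ ν θ + (lam : ℂ))

open Set Filter Topology ComplexConjugate

/-- On the slit plane `e^{tw}/w` has a primitive whose jump between `w` and its conjugate tends
to `2πi` as `w` goes to `-∞` inside a horizontal strip of the upper half-plane. -/
theorem exists_primitive_exp_div {t : ℝ} (ht : 0 ≤ t) :
    ∃ G : ℂ → ℂ, (∀ w ∈ slitPlane, HasDerivAt G (Complex.exp (t * w) / w) w) ∧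
      ∀ {ι : Type} {l : Filter ι} {w : ι → ℂ} {C : ℝ}, Tendsto (fun i => (w i).re) l atBot →
        (∀ᶠ i in l, 0 < (w i).im ∧ (w i).im ≤ C) →
        Tendsto (fun i => G (w i) - G (conj (w i))) l (𝓝 (2 * π * Complex.I)) := by
  set e : ℂ → ℂ := fun w => Complex.exp (t * w) with he
  have hed : Differentiable ℂ e := by fun_prop
  have hq : Differentiable ℂ (dslope e 0) := by
    rw [← differentiableOn_univ]
    exact (Complex.differentiableOn_dslope univ_mem).2 hed.differentiableOn
  have hqv : ∀ w ≠ 0, dslope e 0 w = (Complex.exp (t * w) - 1) / w := by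
    intro w hw
    rw [dslope_of_ne _ hw, slope_def_field]
    simp [he]
  obtain ⟨P, hP⟩ := hq.isExactOn_univ
  refine ⟨fun w => Complex.log w + P w, fun w hw => ?_, fun {ι l w C} hre him => ?_⟩
  · have hw0 := slitPlane_ne_zero hw
    refine ((Complex.hasDerivAt_log hw).add (hP w (mem_univ w))).congr_deriv ?_
    rw [hqv w hw0]
    field_simp
    ring
  · have hinv : Tendsto (fun i => |(w i).re|⁻¹) l (𝓝 0) :=
      (tendsto_abs_atBot_atTop.comp hre).inv_tendsto_atTop
    have hlog : Tendsto (fun i => Complex.log (w i) - Complex.log (conj (w i))) l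
        (𝓝 (2 * π * Complex.I)) := by
      have hdiv : Tendsto (fun i => (-w i).im / ‖w i‖) l (𝓝 0) := by
        refine squeeze_zero_norm' ?_ (by simpa using hinv.const_mul C)
        filter_upwards [him, hre.eventually_lt_atBot 0] with i hi hi'
        have h1 : 0 < |(w i).re| := abs_pos.2 hi'.ne
        rw [norm_div, norm_norm, Complex.neg_im, norm_neg, Real.norm_of_nonneg hi.1.le,
          ← div_eq_mul_inv]
        exact div_le_div₀ (hi.1.le.trans hi.2) hi.2 h1 (Complex.abs_re_le_norm _)
      have harg : Tendsto (fun i => Complex.arg (w i)) l (𝓝 π) := by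
        have h := ((Real.continuous_arcsin.tendsto 0).comp hdiv).add_const π
        rw [Real.arcsin_zero, zero_add] at h
        refine h.congr' ?_
        filter_upwards [him, hre.eventually_lt_atBot 0] with i hi hi'
        exact (Complex.arg_of_re_neg_of_im_nonneg hi' hi.1.le).symm
      have h := ((Complex.continuous_ofReal.tendsto π).comp harg).const_mul 2 |>.mul_const Complex.I
      refine h.congr' ?_
      filter_upwards [him] with i hi
      have : Complex.arg (w i) ≠ π := fun h => hi.1.ne' (Complex.arg_eq_pi_iff.1 h).2
      rw [Complex.log_conj _ this, Complex.sub_conj, Complex.log_im]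
      simp
    have hPlim : Tendsto (fun i => P (w i) - P (conj (w i))) l (𝓝 0) := by
      refine squeeze_zero_norm' ?_ (by simpa using hinv.const_mul (4 * C))
      filter_upwards [him, hre.eventually_lt_atBot 0] with i hi hi'
      have hbd : ∀ v ∈ {v : ℂ | v.re ≤ (w i).re}, ‖dslope e 0 v‖ ≤ 2 * |(w i).re|⁻¹ := by
        intro v hv
        have hv' : v.re ≤ (w i).re := hv
        have hv0 : v ≠ 0 := by rintro rfl; simp at hv'; linarith
        rw [hqv v hv0, norm_div, div_eq_mul_inv]
        have h1 : ‖Complex.exp (t * v) - 1‖ ≤ 2 := by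
          refine (norm_sub_le _ _).trans ?_
          rw [Complex.norm_exp, Complex.re_ofReal_mul, norm_one]
          have : Real.exp (t * v.re) ≤ 1 :=
            Real.exp_le_one_iff.2 (mul_nonpos_of_nonneg_of_nonpos ht (by linarith))
          linarith
        have h2 : |(w i).re| ≤ ‖v‖ := by
          refine le_trans ?_ (Complex.abs_re_le_norm v)
          rw [abs_of_neg hi', abs_of_neg (by linarith)]
          linarith
        have h3 : 0 < |(w i).re| := abs_pos.2 hi'.ne
        gcongr
      have h := (convex_halfSpace_re_le (w i).re).norm_image_sub_le_of_norm_hasDerivWithin_le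
        (x := conj (w i)) (y := w i)
        (fun v _ => (hP v (mem_univ v)).hasDerivWithinAt) hbd (by simp) (by simp)
      refine h.trans ?_
      rw [Complex.sub_conj, norm_mul, Complex.norm_I, mul_one, Complex.norm_real, norm_mul,
        Real.norm_of_nonneg hi.1.le, Real.norm_of_nonneg zero_le_two]
      have h3 : 0 < |(w i).re| := abs_pos.2 hi'.ne
      calc 2 * |(w i).re|⁻¹ * (2 * (w i).im) ≤ 2 * |(w i).re|⁻¹ * (2 * C) := by
            gcongr; exact hi.2
        _ = 4 * C * |(w i).re|⁻¹ := by ring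
    have h := hlog.add hPlim
    rw [add_zero] at h
    refine h.congr fun i => ?_
    ring

section Contour

variable (σ μ ν : ℝ)

theorem classicTalbotZ_of_ne {θ : ℝ} (h : θ ≠ 0) :
    classicTalbotZ σ μ ν θ =
      ((-σ + μ * (θ * (Real.cos θ / Real.sin θ)) : ℝ) : ℂ) + ((ν * θ : ℝ) : ℂ) * Complex.I := by
  simp only [classicTalbotZ, if_neg h, Complex.cot]
  push_cast
  ring

theorem classicTalbotZ_im (θ : ℝ) : (classicTalbotZ σ μ ν θ).im = ν * θ := by
  rcases eq_or_ne θ 0 with rfl | h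
  · simp [classicTalbotZ]
  · rw [classicTalbotZ_of_ne σ μ ν h, Complex.add_im, Complex.ofReal_im, Complex.im_ofReal_mul,
      Complex.I_im, mul_one, zero_add]

theorem classicTalbotZ_re {θ : ℝ} (h : θ ≠ 0) :
    (classicTalbotZ σ μ ν θ).re = -σ + μ * (θ * (Real.cos θ / Real.sin θ)) := by
  rw [classicTalbotZ_of_ne σ μ ν h, Complex.add_re, Complex.ofReal_re, Complex.re_ofReal_mul,
    Complex.I_re, mul_zero, add_zero]

theorem classicTalbotZ_neg (θ : ℝ) :
    classicTalbotZ σ μ ν (-θ) = conj (classicTalbotZ σ μ ν θ) := by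
  rcases eq_or_ne θ 0 with rfl | h
  · simp [classicTalbotZ]
  · apply Complex.ext
    · rw [Complex.conj_re, classicTalbotZ_re σ μ ν h, classicTalbotZ_re σ μ ν (neg_ne_zero.2 h),
        Real.cos_neg, Real.sin_neg]
      ring
    · simp [classicTalbotZ_im]

theorem exists_differentiableOn_eq_classicTalbotZ :
    ∃ (F : ℂ → ℂ) (U : Set ℂ), IsOpen U ∧ (∀ θ ∈ Ioo (-π) π, (θ : ℂ) ∈ U) ∧
      DifferentiableOn ℂ F U ∧ ∀ θ : ℝ, classicTalbotZ σ μ ν θ = F θ := by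
  have hS : Differentiable ℂ (dslope Complex.sin 0) := by
    rw [← differentiableOn_univ]
    exact (Complex.differentiableOn_dslope univ_mem).2 Complex.differentiable_sin.differentiableOn
  have hSv : ∀ w ≠ 0, dslope Complex.sin 0 w = Complex.sin w / w := by
    intro w hw
    rw [dslope_of_ne _ hw, slope_def_field]
    simp
  refine ⟨fun w => -σ + μ * (Complex.cos w / dslope Complex.sin 0 w) + Complex.I * ν * w,
    {w | dslope Complex.sin 0 w ≠ 0}, isOpen_ne_fun hS.continuous continuous_const,
    fun θ hθ => ?_, fun w hw => ?_, fun θ => ?_⟩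
  · rcases eq_or_ne θ 0 with rfl | h
    · simp
    · have hs : Real.sin θ ≠ 0 := fun h' =>
        h ((Real.sin_eq_zero_iff_of_lt_of_lt hθ.1 hθ.2).1 h')
      have hθ0 : (θ : ℂ) ≠ 0 := by exact_mod_cast h
      rw [mem_ofPred_eq, hSv _ hθ0, ← Complex.ofReal_sin]
      exact div_ne_zero (by exact_mod_cast hs) hθ0
  · have h1 := (hS w).fun_inv hw
    simp only [div_eq_mul_inv]
    exact DifferentiableAt.differentiableWithinAt (by fun_prop)
  · rcases eq_or_ne θ 0 with rfl | h
    · simp [classicTalbotZ]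
    · have hθ0 : (θ : ℂ) ≠ 0 := by exact_mod_cast h
      simp only [classicTalbotZ, if_neg h, hSv _ hθ0, div_div_eq_mul_div, Complex.cot]
      ring

theorem differentiableAt_classicTalbotZ {θ : ℝ} (hθ : θ ∈ Ioo (-π) π) :
    DifferentiableAt ℝ (classicTalbotZ σ μ ν) θ := by
  obtain ⟨F, U, hU, hmem, hF, heq⟩ := exists_differentiableOn_eq_classicTalbotZ σ μ ν
  rw [funext heq]
  exact (hF.differentiableAt (hU.mem_nhds (hmem θ hθ))).hasDerivAt.comp_ofReal.differentiableAt

theorem continuousOn_deriv_classicTalbotZ :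
    ContinuousOn (deriv (classicTalbotZ σ μ ν)) (Ioo (-π) π) := by
  obtain ⟨F, U, hU, hmem, hF, heq⟩ := exists_differentiableOn_eq_classicTalbotZ σ μ ν
  have hc : ContinuousOn (fun θ : ℝ => deriv F θ) (Ioo (-π) π) :=
    (hF.deriv hU).continuousOn.comp Complex.continuous_ofReal.continuousOn hmem
  refine hc.congr fun θ hθ => ?_
  rw [funext heq]
  exact (hF.differentiableAt (hU.mem_nhds (hmem θ hθ))).hasDerivAt.comp_ofReal.deriv

theorem norm_deriv_classicTalbotZ_le {μ ν : ℝ} (hμ : 0 ≤ μ) (hν : 0 ≤ ν) {θ : ℝ} (h0 : θ ≠ 0)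
    (hθ : θ ∈ Ioo (-π) π) :
    ‖deriv (classicTalbotZ σ μ ν) θ‖ ≤
      μ * (|Real.cos θ / Real.sin θ| + π * (1 + (Real.cos θ / Real.sin θ) ^ 2)) + ν := by
  have hs : Real.sin θ ≠ 0 := fun h' =>
    h0 ((Real.sin_eq_zero_iff_of_lt_of_lt hθ.1 hθ.2).1 h')
  have hcot : HasDerivAt (fun x => Real.cos x / Real.sin x)
      (-(1 + (Real.cos θ / Real.sin θ) ^ 2)) θ := by
    refine ((Real.hasDerivAt_cos θ).div (Real.hasDerivAt_sin θ) hs).congr_deriv ?_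
    field_simp
    ring
  have hre : HasDerivAt (fun x => -σ + μ * (x * (Real.cos x / Real.sin x)))
      (μ * (Real.cos θ / Real.sin θ + θ * -(1 + (Real.cos θ / Real.sin θ) ^ 2))) θ := by
    have h := (((hasDerivAt_id θ).mul hcot).const_mul μ).const_add (-σ)
    simpa using h
  have him : HasDerivAt (fun x => ν * x) ν θ := by
    simpa using (hasDerivAt_id θ).const_mul ν
  have hz := hre.ofReal_comp.add (him.ofReal_comp.mul_const Complex.I)
  have heq : classicTalbotZ σ μ ν =ᶠ[𝓝 θ] _ :=
    (eventually_ne_nhds h0).mono fun x hx => classicTalbotZ_of_ne σ μ ν hx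
  rw [(hz.congr_of_eventuallyEq heq).deriv]
  refine (norm_add_le _ _).trans ?_
  rw [norm_mul _ Complex.I, Complex.norm_I, mul_one, Complex.norm_real, Complex.norm_real,
    Real.norm_of_nonneg hν, norm_mul, Real.norm_of_nonneg hμ]
  gcongr
  refine (norm_add_le _ _).trans ?_
  rw [norm_mul, norm_neg, Real.norm_eq_abs, Real.norm_eq_abs, Real.norm_of_nonneg (by positivity)]
  gcongr
  exact (abs_lt.2 hθ).le

end Contour

theorem classicTalbotZ_add_mem_slitPlane {σ μ ν lam : ℝ} (hν : 0 < ν) (hlam : σ - μ < lam)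
    (θ : ℝ) : classicTalbotZ σ μ ν θ + lam ∈ slitPlane := by
  rw [mem_slitPlane_iff, Complex.add_im, classicTalbotZ_im, Complex.ofReal_im, add_zero]
  rcases eq_or_ne θ 0 with rfl | h
  · left
    simp only [classicTalbotZ, if_true, Complex.add_re, Complex.neg_re, Complex.ofReal_re]
    linarith
  · exact Or.inr (mul_ne_zero hν.ne' h)

theorem mul_cos_div_sin_nonpos {θ : ℝ} (hθ : θ ∈ Ioo (-π) π) (h : π / 2 ≤ |θ|) :
    θ * (Real.cos θ / Real.sin θ) ≤ 0 := by
  have key : ∀ x : ℝ, π / 2 ≤ x → x < π → x * (Real.cos x / Real.sin x) ≤ 0 := fun x h1 h2 =>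
    mul_nonpos_of_nonneg_of_nonpos (by linarith [Real.pi_pos])
      (div_nonpos_of_nonpos_of_nonneg
        (Real.cos_nonpos_of_pi_div_two_le_of_le h1 (by linarith [Real.pi_pos]))
        (Real.sin_nonneg_of_nonneg_of_le_pi (by linarith [Real.pi_pos]) h2.le))
  rcases abs_cases θ with ⟨ha, -⟩ | ⟨ha, -⟩ <;> rw [ha] at h
  · exact key θ h hθ.2
  · have := key (-θ) h (by linarith [hθ.1])
    rw [Real.cos_neg, Real.sin_neg] at this
    convert this using 1
    ring

theorem one_add_sq_le_mul_exp {c s : ℝ} (hc : 0 < c) (hs : 0 ≤ s) :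
    (1 + s) ^ 2 ≤ (1 + 2 / c) ^ 2 * Real.exp (c * s) := by
  have h1 : 1 + s ≤ (1 + 2 / c) * Real.exp (c * s / 2) := by
    calc 1 + s ≤ (1 + 2 / c) * (c * s / 2 + 1) := by
          have : 2 / c * (c * s / 2) = s := by field_simp
          have : 0 ≤ 2 / c := by positivity
          have : 0 ≤ c * s := by positivity
          linarith
      _ ≤ _ := by gcongr; exact Real.add_one_le_exp _
  calc (1 + s) ^ 2 ≤ ((1 + 2 / c) * Real.exp (c * s / 2)) ^ 2 := by gcongr
    _ = _ := by rw [mul_pow, ← Real.exp_nat_mul]; congr 2; push_cast; ring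

section Integrand

variable {σ μ ν lam t : ℝ}

theorem talbotBromwichIntegrand_of_mem {θ : ℝ} (hθ : θ ∈ Ioo (-π) π) :
    talbotBromwichIntegrand σ μ ν lam t θ = Complex.exp (t * classicTalbotZ σ μ ν θ) *
        deriv (classicTalbotZ σ μ ν) θ / (classicTalbotZ σ μ ν θ + lam) :=
  if_neg (not_or.2 ⟨hθ.2.ne, hθ.1.ne'⟩)

theorem continuousOn_talbotBromwichIntegrand (hν : 0 < ν) (hlam : σ - μ < lam) :
    ContinuousOn (talbotBromwichIntegrand σ μ ν lam t) (Ioo (-π) π) := by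
  have hz : ContinuousOn (classicTalbotZ σ μ ν) (Ioo (-π) π) := fun θ hθ =>
    (differentiableAt_classicTalbotZ σ μ ν hθ).continuousAt.continuousWithinAt
  refine ContinuousOn.congr (ContinuousOn.div ?_ (hz.add continuousOn_const)
    fun θ _ => slitPlane_ne_zero (classicTalbotZ_add_mem_slitPlane hν hlam θ))
    fun θ hθ => talbotBromwichIntegrand_of_mem hθ
  exact (continuousOn_const.mul hz).cexp.mul (continuousOn_deriv_classicTalbotZ σ μ ν)

theorem norm_talbotBromwichIntegrand_le (ht : 0 < t) (hμ : 0 < μ) (hν : 0 < ν) {θ : ℝ}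
    (hθ : θ ∈ Ioo (-π) π) (h : π / 2 ≤ |θ|) :
    ‖talbotBromwichIntegrand σ μ ν lam t θ‖ ≤
      Real.exp (-(t * σ)) * ((μ + μ * π + ν) * (1 + 2 / (t * μ)) ^ 2) / ν := by
  have h1 : 1 ≤ |θ| := by linarith [Real.pi_gt_three]
  have h0 : θ ≠ 0 := by rintro rfl; norm_num at h1
  set k := Real.cos θ / Real.sin θ with hk
  set s := -(θ * k) with hs
  have hs0 : 0 ≤ s := neg_nonneg.2 (mul_cos_div_sin_nonpos hθ h)
  have hks : |k| ≤ s := by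
    rw [← abs_of_nonneg hs0, hs, abs_neg, abs_mul]
    exact le_mul_of_one_le_left (abs_nonneg k) h1
  have hk2 : k ^ 2 ≤ s ^ 2 := sq_le_sq' (by linarith [neg_abs_le k]) ((le_abs_self k).trans hks)
  have hden : ν ≤ ‖classicTalbotZ σ μ ν θ + lam‖ := by
    refine le_trans ?_ (Complex.abs_im_le_norm _)
    rw [Complex.add_im, classicTalbotZ_im, Complex.ofReal_im, add_zero, abs_mul, abs_of_pos hν]
    exact le_mul_of_one_le_right hν.le h1
  have hder : ‖deriv (classicTalbotZ σ μ ν) θ‖ ≤ (μ + μ * π + ν) * (1 + s) ^ 2 := by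
    calc _ ≤ μ * (|k| + π * (1 + k ^ 2)) + ν := norm_deriv_classicTalbotZ_le σ hμ.le hν.le h0 hθ
      _ ≤ μ * (s + π * (1 + s ^ 2)) + ν := by gcongr
      _ ≤ μ * ((1 + s) ^ 2 + π * (1 + s) ^ 2) + ν * (1 + s) ^ 2 := by
          gcongr
          · nlinarith
          · nlinarith
          · exact le_mul_of_one_le_right hν.le (by nlinarith)
      _ = _ := by ring
  rw [talbotBromwichIntegrand_of_mem hθ, norm_div, norm_mul, Complex.norm_exp,
    Complex.re_ofReal_mul, classicTalbotZ_re σ μ ν h0, ← hk,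
    show t * (-σ + μ * (θ * k)) = -(t * σ) + -(t * μ * s) by rw [hs]; ring, Real.exp_add, mul_assoc]
  refine div_le_div₀ (by positivity) (mul_le_mul_of_nonneg_left ?_ (Real.exp_pos _).le) hν hden
  calc _ ≤ Real.exp (-(t * μ * s)) * ((μ + μ * π + ν) *
        ((1 + 2 / (t * μ)) ^ 2 * Real.exp (t * μ * s))) := by
          gcongr
          refine hder.trans ?_
          gcongr
          exact one_add_sq_le_mul_exp (by positivity) hs0
    _ = (μ + μ * π + ν) * (1 + 2 / (t * μ)) ^ 2 *
        (Real.exp (-(t * μ * s)) * Real.exp (t * μ * s)) := by ring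
    _ = _ := by rw [← Real.exp_add, neg_add_cancel, Real.exp_zero, mul_one]

theorem intervalIntegrable_talbotBromwichIntegrand (ht : 0 < t) (hμ : 0 < μ) (hν : 0 < ν)
    (hlam : σ - μ < lam) :
    IntervalIntegrable (talbotBromwichIntegrand σ μ ν lam t) volume (-π) π := by
  have hπ := Real.pi_pos
  have hcont := continuousOn_talbotBromwichIntegrand (t := t) hν hlam
  obtain ⟨K, hK⟩ := (isCompact_Icc (a := -(π / 2)) (b := π / 2)).exists_bound_of_continuousOn
    (hcont.mono (Icc_subset_Ioo (by linarith) (by linarith)))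
  rw [intervalIntegrable_iff_integrableOn_Ioo_of_le (by linarith)]
  refine Integrable.of_bound (hcont.aestronglyMeasurable measurableSet_Ioo)
    (max K (Real.exp (-(t * σ)) * ((μ + μ * π + ν) * (1 + 2 / (t * μ)) ^ 2) / ν)) ?_
  refine (ae_restrict_mem measurableSet_Ioo).mono fun θ hθ => ?_
  rcases le_total |θ| (π / 2) with h | h
  · exact (hK θ (abs_le.1 h)).trans (le_max_left _ _)
  · exact (norm_talbotBromwichIntegrand_le ht hμ hν hθ h).trans (le_max_right _ _)

theorem tendsto_classicTalbotZ_re_atBot (hμ : 0 < μ) :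
    Tendsto (fun θ => (classicTalbotZ σ μ ν θ).re) (𝓝[<] π) atBot := by
  have hsin : Tendsto Real.sin (𝓝[<] π) (𝓝[>] 0) := by
    refine tendsto_nhdsWithin_iff.2 ⟨?_, ?_⟩
    · simpa using (Real.continuous_sin.tendsto π).mono_left nhdsWithin_le_nhds
    · filter_upwards [Ioo_mem_nhdsLT Real.pi_pos] with θ hθ
      exact Real.sin_pos_of_pos_of_lt_pi hθ.1 hθ.2
  have hcos : Tendsto (fun θ => μ * (θ * Real.cos θ)) (𝓝[<] π) (𝓝 (-(μ * π))) := by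
    have : Continuous fun θ => μ * (θ * Real.cos θ) := by fun_prop
    simpa using (this.tendsto π).mono_left nhdsWithin_le_nhds
  have h := hcos.neg_mul_atTop (neg_lt_zero.2 (mul_pos hμ Real.pi_pos))
    (tendsto_inv_nhdsGT_zero.comp hsin)
  refine (tendsto_atBot_add_const_left _ (-σ) h).congr' ?_
  filter_upwards [Ioo_mem_nhdsLT Real.pi_pos] with θ hθ
  rw [classicTalbotZ_re σ μ ν hθ.1.ne']
  simp only [Function.comp_apply]
  ring

theorem integral_talbotBromwichIntegrand (ht : 0 < t) (hμ : 0 < μ) (hν : 0 < ν)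
    (hlam : σ - μ < lam) :
    ∫ θ in (-π)..π, talbotBromwichIntegrand σ μ ν lam t θ =
      Complex.exp (-(lam * t)) * (2 * π * Complex.I) := by
  have hπ := Real.pi_pos
  obtain ⟨G, hG, hlim⟩ := exists_primitive_exp_div ht.le
  set g := talbotBromwichIntegrand σ μ ν lam t
  set W : ℝ → ℂ := fun θ => classicTalbotZ σ μ ν θ + lam with hW
  have hWneg : ∀ θ, W (-θ) = conj (W θ) := fun θ => by simp [hW, classicTalbotZ_neg]
  have hgi : IntervalIntegrable g volume (-π) π :=
    intervalIntegrable_talbotBromwichIntegrand ht hμ hν hlam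
  have hderiv : ∀ θ ∈ Ioo (-π) π,
      HasDerivAt (fun θ => Complex.exp (-(lam * t)) * G (W θ)) (g θ) θ := by
    intro θ hθ
    have h1 := ((differentiableAt_classicTalbotZ σ μ ν hθ).hasDerivAt).add_const (lam : ℂ)
    have h2 := ((hG (W θ) (classicTalbotZ_add_mem_slitPlane hν hlam θ)).comp θ h1).const_mul
      (Complex.exp (-(lam * t)))
    refine h2.congr_deriv ?_
    rw [show g θ = _ from talbotBromwichIntegrand_of_mem hθ, hW,
      show (t : ℂ) * classicTalbotZ σ μ ν θ
        = -(lam * t) + t * (classicTalbotZ σ μ ν θ + lam) by ring, Complex.exp_add]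
    ring
  set H : ℝ → ℂ := fun θ => Complex.exp (-(lam * t)) * G (W θ) with hH
  have hHd : ∀ θ ∈ Ioo (-π) π, HasDerivAt (fun θ => H θ - H (-θ)) (g θ + g (-θ)) θ := by
    intro θ hθ
    have h2 : HasDerivAt (fun θ => H (-θ)) (-g (-θ)) θ :=
      ((hderiv (-θ) ⟨by linarith [hθ.2], by linarith [hθ.1]⟩).scomp θ
        (hasDerivAt_neg θ)).congr_deriv (by simp)
    exact ((hderiv θ hθ).sub h2).congr_deriv (sub_neg_eq_add _ _)
  have hg0 : IntervalIntegrable g volume 0 π := hgi.mono_set (by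
    rw [uIcc_of_le hπ.le, uIcc_of_le (by linarith)]
    exact Icc_subset_Icc_left (by linarith))
  have hg1 : IntervalIntegrable g volume (-π) 0 := hgi.mono_set (by
    rw [uIcc_of_le (by linarith), uIcc_of_le (by linarith)]
    exact Icc_subset_Icc_right (by linarith))
  have hgn : IntervalIntegrable (fun θ => g (-θ)) volume 0 π := by
    simpa using ((IntervalIntegrable.iff_comp_neg).1 hg1).symm
  have hstart : Tendsto (fun θ => H θ - H (-θ)) (𝓝[>] 0) (𝓝 0) := by
    have h := (hHd 0 ⟨by linarith, hπ⟩).continuousAt.tendsto.mono_left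
      (nhdsWithin_le_nhds (s := Ioi 0))
    simpa using h
  have hend : Tendsto (fun θ => H θ - H (-θ)) (𝓝[<] π)
      (𝓝 (Complex.exp (-(lam * t)) * (2 * π * Complex.I))) := by
    have hre : Tendsto (fun θ => (W θ).re) (𝓝[<] π) atBot := by
      simpa [hW] using tendsto_atBot_add_const_right _ lam
        (tendsto_classicTalbotZ_re_atBot (σ := σ) (ν := ν) hμ)
    have him : ∀ᶠ θ in 𝓝[<] π, 0 < (W θ).im ∧ (W θ).im ≤ ν * π := by
      filter_upwards [Ioo_mem_nhdsLT hπ] with θ hθ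
      simp only [hW, Complex.add_im, classicTalbotZ_im, Complex.ofReal_im, add_zero]
      exact ⟨mul_pos hν hθ.1, mul_le_mul_of_nonneg_left hθ.2.le hν.le⟩
    refine ((hlim hre him).const_mul (Complex.exp (-(lam * t)))).congr fun θ => ?_
    simp only [hH, hWneg, mul_sub]
  have hFTC := intervalIntegral.integral_eq_sub_of_hasDerivAt_of_tendsto hπ
    (fun θ hθ => hHd θ ⟨by linarith [hθ.1], hθ.2⟩) (hg0.add hgn) hstart hend
  rw [intervalIntegral.integral_add hg0 hgn, intervalIntegral.integral_comp_neg, neg_zero,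
    sub_zero] at hFTC
  rw [← intervalIntegral.integral_add_adjacent_intervals hg1 hg0, add_comm, hFTC]

end Integrand

/-- **Talbot contour inversion of `F(z) = 1/(z+λ)`.** For `t, μ, ν > 0` and
`λ > σ - μ`, the integrand `g` is integrable on `[-π, π]` and
`(1/(2πi)) ∫_{-π}^{π} g(θ) dθ = e^{-λt}`. -/
theorem talbot_inversion_reciprocal
    (σ μ ν lam t : ℝ) (ht : 0 < t) (hμ : 0 < μ) (hν : 0 < ν)
    (hlam : σ - μ < lam) :
    IntervalIntegrable (talbotBromwichIntegrand σ μ ν lam t) volume (-π) π ∧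
    (1 / (2 * (π : ℂ) * Complex.I)) *
        ∫ θ in (-π : ℝ)..π, talbotBromwichIntegrand σ μ ν lam t θ =
      Complex.exp (-((lam : ℂ) * (t : ℂ))) := by
  refine ⟨intervalIntegrable_talbotBromwichIntegrand ht hμ hν hlam, ?_⟩
  have hπ : (π : ℂ) ≠ 0 := Complex.ofReal_ne_zero.2 Real.pi_ne_zero
  rw [integral_talbotBromwichIntegrand ht hμ hν hlam]
  field_simp
end
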